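/- arXiv:quant-ph/0403140 — 2 statements merged into one kernel-verified Lean document; each statement's English description precedes it below -/
import Mathlib

section
/- Every one-round, (1−η)-secure, 2-server private information retrieval scheme for n-bit databases with query size t, answer size ℓ, recovery probability 1/2 + ε (with ε > η), using b bits, satisfies t ≥ d·n − log₂ u − log₂ 6, where u = Σ_{i=0}^{b} binom(ℓ, i) and d = (1 − H(1/2 + (ε−η)/2^{b+1})) · 2^{b+1}/(3u). -/
/-- A one-round 2-server private information retrieval scheme for `n`-bit databases
with query size `t` and answer size `ℓ`: a finite probability space `Fin R` with
weights `pr` (the user's randomness), query functions `q1, q2`, the two servers'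
answer functions `ans1, ans2`, and the user's output functions `out`. -/
structure PIRScheme (n t ℓ : ℕ) where
  R : ℕ
  pr : Fin R → ℝ
  q1 : Fin n → Fin R → Fin t → Bool
  q2 : Fin n → Fin R → Fin t → Bool
  ans1 : (Fin n → Bool) → (Fin t → Bool) → Fin ℓ → Bool
  ans2 : (Fin n → Bool) → (Fin t → Bool) → Fin ℓ → Bool
  out : Fin n → Fin R → (Fin ℓ → Bool) → (Fin ℓ → Bool) → Bool

/-- The user's randomness is a probability distribution. -/
def PIRScheme.ProbDist {n t ℓ : ℕ} (P : PIRScheme n t ℓ) : Prop :=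
  (∀ r, 0 ≤ P.pr r) ∧ ∑ r, P.pr r = 1

/-- Recovery probability at least `1/2 + ε`: for every database `x` and index `i`, the
user outputs `x_i` with probability at least `1/2 + ε`. -/
def PIRScheme.Correct {n t ℓ : ℕ} (P : PIRScheme n t ℓ) (ε : ℝ) : Prop :=
  ∀ (x : Fin n → Bool) (i : Fin n),
    1 / 2 + ε ≤
      ∑ r ∈ Finset.univ.filter
        (fun r => P.out i r (P.ans1 x (P.q1 i r)) (P.ans2 x (P.q2 i r)) = x i),
        P.pr r

/-- `(1-η)`-security: for each server, the distributions of the query induced by any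
two indices `i1, i2` are within total variation distance `η`. -/
def PIRScheme.Secure {n t ℓ : ℕ} (P : PIRScheme n t ℓ) (η : ℝ) : Prop :=
  ∀ i1 i2 : Fin n,
    (1 / 2) * ∑ q : Fin t → Bool,
      |(∑ r ∈ Finset.univ.filter (fun r => P.q1 i1 r = q), P.pr r) -
        (∑ r ∈ Finset.univ.filter (fun r => P.q1 i2 r = q), P.pr r)| ≤ η ∧
    (1 / 2) * ∑ q : Fin t → Bool,
      |(∑ r ∈ Finset.univ.filter (fun r => P.q2 i1 r = q), P.pr r) -
        (∑ r ∈ Finset.univ.filter (fun r => P.q2 i2 r = q), P.pr r)| ≤ η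

/-- The scheme uses only `b` (predetermined, depending on `i` and `r`) bits of each of
the two `ℓ`-bit answers. -/
def PIRScheme.UsesBits {n t ℓ : ℕ} (P : PIRScheme n t ℓ) (b : ℕ) : Prop :=
  ∀ (i : Fin n) (r : Fin P.R),
    ∃ S0 S1 : Finset (Fin ℓ), S0.card = b ∧ S1.card = b ∧
      ∀ a0 a1 a0' a1' : Fin ℓ → Bool,
        (∀ k ∈ S0, a0 k = a0' k) → (∀ k ∈ S1, a1 k = a1' k) →
          P.out i r a0 a1 = P.out i r a0' a1'

/-- The binary entropy function `H(p) = -p log₂ p - (1-p) log₂ (1-p)`. -/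
noncomputable def binEnt (p : ℝ) : ℝ :=
  -p * Real.logb 2 p - (1 - p) * Real.logb 2 (1 - p)

section

open Matrix Filter Topology

section Trace

variable {ι κ : Type*} [Fintype ι] [DecidableEq ι] [Fintype κ] [DecidableEq κ]

theorem Matrix.mul_pow_mul_comm (A : Matrix ι κ ℝ) (B : Matrix κ ι ℝ) (m : ℕ) :
    (A * B) ^ m * A = A * (B * A) ^ m := by
  induction m with
  | zero => simp
  | succ m ih => rw [pow_succ', pow_succ', Matrix.mul_assoc, ih]; simp only [Matrix.mul_assoc]

theorem Matrix.trace_mul_pow_comm (A : Matrix ι κ ℝ) (B : Matrix κ ι ℝ) {m : ℕ} (hm : m ≠ 0) :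
    ((A * B) ^ m).trace = ((B * A) ^ m).trace := by
  obtain ⟨m, rfl⟩ := Nat.exists_eq_succ_of_ne_zero hm
  rw [Nat.succ_eq_add_one, pow_succ, ← Matrix.mul_assoc, mul_pow_mul_comm, Matrix.mul_assoc,
    trace_mul_comm, Matrix.mul_assoc, ← pow_succ]

omit [DecidableEq ι] in
theorem Matrix.trace_mul_le (A B : Matrix ι ι ℝ) :
    (A * B).trace ≤ ((A * Aᵀ).trace + (B * Bᵀ).trace) / 2 := by
  have h1 : (A * B).trace = ∑ i, ∑ j, A i j * B j i := by simp [trace, mul_apply]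
  have h2 : (A * Aᵀ).trace = ∑ i, ∑ j, A i j * A i j := by simp [trace, mul_apply]
  have h3 : (B * Bᵀ).trace = ∑ i, ∑ j, B j i * B j i := by
    rw [Finset.sum_comm]; simp [trace, mul_apply]
  rw [h1, h2, h3, ← Finset.sum_add_distrib, Finset.sum_div]
  refine Finset.sum_le_sum fun i _ => ?_
  rw [← Finset.sum_add_distrib, Finset.sum_div]
  refine Finset.sum_le_sum fun j _ => ?_
  nlinarith [sq_nonneg (A i j - B j i)]

theorem Matrix.trace_pow_le_and_trace_mul_pow_le (k : ℕ) :
    (∀ C : Matrix ι ι ℝ, (C ^ 2 ^ (k + 1)).trace ≤ ((C * Cᵀ) ^ 2 ^ k).trace) ∧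
    (∀ P Q : Matrix ι ι ℝ, P.IsSymm → Q.IsSymm →
      ((P * Q) ^ 2 ^ k).trace ≤ (P ^ 2 ^ k * Q ^ 2 ^ k).trace) := by
  induction k with
  | zero =>
    refine ⟨fun C => ?_, fun P Q _ _ => by simp⟩
    have h := trace_mul_le C C
    simp only [zero_add, pow_one, pow_zero, pow_two]
    linarith
  | succ k ih =>
    obtain ⟨ihC, ihPQ⟩ := ih
    have h2 : (2 : ℕ) ^ k ≠ 0 := by positivity
    constructor
    · intro C
      have hP : (Cᵀ * C).IsSymm := isSymm_transpose_mul_self C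
      have hQ : (C * Cᵀ).IsSymm := isSymm_mul_transpose_self C
      calc (C ^ 2 ^ (k + 1 + 1)).trace = ((C * C) ^ 2 ^ (k + 1)).trace := by
            rw [← pow_two, ← pow_mul, pow_succ' 2 (k + 1)]
        _ ≤ ((C * C * (C * C)ᵀ) ^ 2 ^ k).trace := ihC _
        _ = ((Cᵀ * C * (C * Cᵀ)) ^ 2 ^ k).trace := by
            rw [transpose_mul, ← Matrix.mul_assoc, trace_mul_pow_comm _ _ h2]
            simp only [Matrix.mul_assoc]
        _ ≤ ((Cᵀ * C) ^ 2 ^ k * (C * Cᵀ) ^ 2 ^ k).trace := ihPQ _ _ hP hQ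
        _ ≤ _ := trace_mul_le _ _
        _ = ((C * Cᵀ) ^ 2 ^ (k + 1)).trace := by
            rw [(hP.pow _).eq, (hQ.pow _).eq, ← pow_add, ← pow_add, ← two_mul, ← pow_succ',
              trace_mul_pow_comm Cᵀ C (by positivity)]
            ring
    · intro P Q hP hQ
      calc ((P * Q) ^ 2 ^ (k + 1)).trace ≤ ((P * Q * (P * Q)ᵀ) ^ 2 ^ k).trace := ihC _
        _ = ((P ^ 2 * Q ^ 2) ^ 2 ^ k).trace := by
            rw [transpose_mul, hP.eq, hQ.eq, ← Matrix.mul_assoc, trace_mul_pow_comm _ _ h2]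
            simp only [Matrix.mul_assoc, pow_two]
        _ ≤ ((P ^ 2) ^ 2 ^ k * (Q ^ 2) ^ 2 ^ k).trace := ihPQ _ _ (hP.pow 2) (hQ.pow 2)
        _ = _ := by rw [← pow_mul, ← pow_mul, ← pow_succ']

end Trace

section Trotter

variable {𝔸 : Type*} [NormedRing 𝔸] [NormOneClass 𝔸]

theorem norm_pow_sub_pow_le {X Y : 𝔸} {M : ℝ} (hM : 1 ≤ M) (hX : ‖X‖ ≤ M) (hY : ‖Y‖ ≤ M)
    (N : ℕ) : ‖X ^ N - Y ^ N‖ ≤ N * M ^ N * ‖X - Y‖ := by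
  induction N with
  | zero => simp
  | succ N ih =>
    have h : X ^ (N + 1) - Y ^ (N + 1) = X ^ N * (X - Y) + (X ^ N - Y ^ N) * Y := by
      rw [pow_succ, pow_succ]; noncomm_ring
    have hXN : ‖X ^ N‖ ≤ M ^ N := (norm_pow_le X N).trans (by gcongr)
    have hMN : M ^ N ≤ M ^ (N + 1) := pow_le_pow_right₀ hM (Nat.le_succ N)
    calc ‖X ^ (N + 1) - Y ^ (N + 1)‖
        ≤ ‖X ^ N‖ * ‖X - Y‖ + ‖X ^ N - Y ^ N‖ * ‖Y‖ := by
          rw [h]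
          exact (norm_add_le _ _).trans (add_le_add (norm_mul_le _ _) (norm_mul_le _ _))
      _ ≤ M ^ (N + 1) * ‖X - Y‖ + N * M ^ N * ‖X - Y‖ * M := by gcongr; exact hXN.trans hMN
      _ = _ := by push_cast; ring

theorem HasDerivAt.tendsto_pow_exp [NormedAlgebra ℝ 𝔸] [CompleteSpace 𝔸] {f : ℝ → 𝔸} {B : 𝔸}
    (hf : HasDerivAt f B 0) (h0 : f 0 = 1) :
    Tendsto (fun N : ℕ => f ((N : ℝ)⁻¹) ^ N) atTop (𝓝 (NormedSpace.exp B)) := by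
  have hg : HasDerivAt (fun t : ℝ => NormedSpace.exp (t • B)) B 0 := by
    simpa using hasDerivAt_exp_smul_const (𝕂 := ℝ) B 0
  have hbound : ∀ g : ℝ → 𝔸, HasDerivAt g B 0 → g 0 = 1 →
      ∀ᶠ t in 𝓝 (0 : ℝ), ‖g t‖ ≤ 1 + (‖B‖ + 1) * |t| := by
    intro g hg hg0
    have := (hasDerivAt_iff_isLittleO.1 hg).def (c := 1) one_pos
    filter_upwards [this] with t ht
    simp only [hg0, sub_zero, one_mul, Real.norm_eq_abs] at ht
    have e : g t = (g t - 1 - t • B) + 1 + t • B := by abel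
    have h1 : ‖t • B‖ ≤ |t| * ‖B‖ := by rw [norm_smul, Real.norm_eq_abs]
    calc ‖g t‖ ≤ ‖g t - 1 - t • B‖ + ‖(1 : 𝔸)‖ + ‖t • B‖ := by
          conv_lhs => rw [e]
          exact norm_add₃_le
      _ ≤ |t| + 1 + |t| * ‖B‖ := by rw [norm_one]; gcongr
      _ = _ := by ring
  have hdiff : HasDerivAt (fun t => f t - NormedSpace.exp (t • B)) 0 0 := by
    have h := hf.sub hg
    rw [sub_self] at h
    exact h
  have hinv : Tendsto (fun N : ℕ => ((N : ℝ))⁻¹) atTop (𝓝 0) :=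
    tendsto_inv_atTop_nhds_zero_nat
  set K := ‖B‖ + 1 with hK
  have hKpos : 0 < K := by positivity
  rw [Metric.tendsto_atTop']
  intro ε hε
  have hd := (hasDerivAt_iff_isLittleO.1 hdiff).def
    (c := ε / (2 * Real.exp K)) (by positivity)
  have hev := hinv.eventually ((hbound f hf h0).and ((hbound _ hg (by simp)).and hd))
  obtain ⟨N₀, hN₀⟩ := (hev.and (eventually_gt_atTop 0)).exists_forall_of_atTop
  refine ⟨N₀, fun N hN => ?_⟩
  obtain ⟨⟨h1, h2, h3⟩, hNpos⟩ := hN₀ N hN.le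
  have hNpos' : (0 : ℝ) < N := by exact_mod_cast hNpos
  have hexp : NormedSpace.exp B = NormedSpace.exp ((N : ℝ)⁻¹ • B) ^ N := by
    let _ : NormedAlgebra ℚ 𝔸 := .restrictScalars ℚ ℝ 𝔸
    rw [← NormedSpace.exp_nsmul, ← Nat.cast_smul_eq_nsmul ℝ, smul_smul,
      mul_inv_cancel₀ hNpos'.ne', one_smul]
  have habs : |(N : ℝ)⁻¹| = (N : ℝ)⁻¹ := abs_of_pos (by positivity)
  rw [habs] at h1 h2
  simp only [h0, zero_smul, NormedSpace.exp_zero, sub_self, sub_zero, smul_zero,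
    Real.norm_eq_abs, habs] at h3
  rw [dist_eq_norm, hexp]
  have hMexp : (1 + K * (N : ℝ)⁻¹) ^ N ≤ Real.exp K := by
    calc (1 + K * (N : ℝ)⁻¹) ^ N ≤ (Real.exp (K * (N : ℝ)⁻¹)) ^ N := by
          gcongr
          linarith [Real.add_one_le_exp (K * (N : ℝ)⁻¹)]
      _ = Real.exp K := by
          rw [← Real.exp_nat_mul]; congr 1; field_simp
  have hM : 1 ≤ 1 + K * (N : ℝ)⁻¹ := by
    have : 0 < K * (N : ℝ)⁻¹ := by positivity
    linarith
  calc _ ≤ N * (1 + K * (N : ℝ)⁻¹) ^ N * _ := norm_pow_sub_pow_le hM h1 h2 N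
    _ ≤ N * Real.exp K * (ε / (2 * Real.exp K) * (N : ℝ)⁻¹) := by gcongr
    _ = ε / 2 := by field_simp
    _ < ε := half_lt_self hε

end Trotter

section GoldenThompson

variable {ι κ : Type*} [Fintype ι] [DecidableEq ι] [Fintype κ] [DecidableEq κ]

attribute [local instance] Matrix.linftyOpNormedRing Matrix.linftyOpNormedAlgebra
  Matrix.linftyOpNormedAddCommGroup Matrix.linftyOpNormedSpace

theorem Matrix.trace_exp_add_le [Nonempty ι] {A : Matrix ι ι ℝ} (hA : A.IsSymm)
    (V : Matrix κ ι ℝ) (hV : Vᵀ * V = 1) (y : κ → ℝ) :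
    (NormedSpace.exp (A + Vᵀ * diagonal y * V)).trace ≤
      (NormedSpace.exp A * (Vᵀ * diagonal (fun k => Real.exp (y k)) * V)).trace := by
  set f : ℝ → Matrix ι ι ℝ := fun t =>
    NormedSpace.exp (t • A) * (Vᵀ * diagonal (fun k => Real.exp (t * y k)) * V) with hfdef
  have hf0 : f 0 = 1 := by simp [hfdef, hV]
  have hE : HasDerivAt (fun t : ℝ => Vᵀ * diagonal (fun k => Real.exp (t * y k)) * V)
      (Vᵀ * diagonal y * V) 0 := by
    have h : HasDerivAt (fun t : ℝ => ∑ k, Real.exp (t * y k) • vecMulVec (V k) (V k))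
        (∑ k, y k • vecMulVec (V k) (V k)) 0 := by
      refine HasDerivAt.fun_sum fun k _ => HasDerivAt.smul_const ?_ _
      simpa using ((hasDerivAt_id (0 : ℝ)).mul_const (y k)).exp
    have e : ∀ z : κ → ℝ, Vᵀ * diagonal z * V = ∑ k, z k • vecMulVec (V k) (V k) := by
      intro z
      ext i j
      rw [mul_apply, sum_apply]
      refine Finset.sum_congr rfl fun k _ => ?_
      rw [mul_diagonal, transpose_apply, smul_apply, vecMulVec_apply, smul_eq_mul]
      ring
    simp only [e]
    exact h
  have hfd : HasDerivAt f (A + Vᵀ * diagonal y * V) 0 := by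
    have h := (hasDerivAt_exp_smul_const (𝕂 := ℝ) A 0).mul hE
    simp only [zero_smul, NormedSpace.exp_zero, zero_mul, Real.exp_zero, diagonal_one,
      Matrix.mul_one, hV, Matrix.one_mul] at h
    exact h
  have hlim := hfd.tendsto_pow_exp hf0
  have hlim2 := hlim.comp (tendsto_pow_atTop_atTop_of_one_lt (r := 2) one_lt_two)
  have hcont : Continuous (fun M : Matrix ι ι ℝ => M.trace) := by fun_prop
  refine le_of_tendsto ((hcont.tendsto _).comp hlim2) (Eventually.of_forall fun k => ?_)
  simp only [Function.comp_apply, hfdef]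
  set N := 2 ^ k with hN
  have hN0 : N ≠ 0 := by positivity
  have hNR : ((N : ℕ) : ℝ) ≠ 0 := by exact_mod_cast hN0
  set a := NormedSpace.exp (((N : ℝ)⁻¹) • A) with ha
  set D := diagonal (fun k => Real.exp ((N : ℝ)⁻¹ * y k)) with hD
  have haS : a.IsSymm := (hA.smul _).exp
  have haN : a ^ N = NormedSpace.exp A := by
    rw [ha, ← Matrix.exp_nsmul, ← Nat.cast_smul_eq_nsmul ℝ, smul_smul, mul_inv_cancel₀ hNR,
      one_smul]
  have hDN : D ^ N = diagonal (fun k => Real.exp (y k)) := by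
    rw [hD, diagonal_pow]
    congr 1
    ext k
    simp only [Pi.pow_apply]
    rw [← Real.exp_nat_mul]
    congr 1
    field_simp
  have hconj : (V * a * Vᵀ) ^ N = V * a ^ N * Vᵀ := by
    have h : ∀ m : ℕ, (V * a * Vᵀ) ^ (m + 1) = V * a ^ (m + 1) * Vᵀ := by
      intro m
      induction m with
      | zero => simp
      | succ m ih =>
        rw [pow_succ, ih, pow_succ a (m + 1)]
        calc V * a ^ (m + 1) * Vᵀ * (V * a * Vᵀ)
            = V * a ^ (m + 1) * (Vᵀ * V) * a * Vᵀ := by simp only [Matrix.mul_assoc]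
          _ = _ := by rw [hV, Matrix.mul_one]; simp only [Matrix.mul_assoc]
    obtain ⟨m, hm⟩ := Nat.exists_eq_succ_of_ne_zero hN0
    rw [hm]; exact h m
  calc ((a * (Vᵀ * D * V)) ^ N).trace = ((V * a * Vᵀ * D) ^ N).trace := by
        rw [← Matrix.mul_assoc, trace_mul_pow_comm _ _ hN0]
        simp only [Matrix.mul_assoc]
    _ ≤ ((V * a * Vᵀ) ^ N * D ^ N).trace :=
        (trace_pow_le_and_trace_mul_pow_le k).2 _ _
          (by rw [IsSymm, transpose_mul, transpose_mul, transpose_transpose, haS.eq,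
            Matrix.mul_assoc]) (isSymm_diagonal _)
    _ = _ := by
        rw [hconj, haN, hDN, Matrix.mul_assoc, Matrix.mul_assoc, trace_mul_comm V]
        simp only [Matrix.mul_assoc]

theorem Matrix.exp_dotProduct_le_trace_exp {S : Matrix ι ι ℝ} (hS : S.IsSymm) {v : ι → ℝ}
    (hv : v ⬝ᵥ v = 1) :
    Real.exp (v ⬝ᵥ S *ᵥ v) ≤ (NormedSpace.exp S).trace := by
  have hH : S.IsHermitian := by rwa [IsHermitian, conjTranspose_eq_transpose_of_trivial]
  set U : Matrix ι ι ℝ := (hH.eigenvectorUnitary : Matrix ι ι ℝ) with hU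
  have hUU : U * Uᵀ = 1 := by
    have := Unitary.coe_mul_star_self hH.eigenvectorUnitary
    simpa [star_eq_conjTranspose] using this
  have hUU' : Uᵀ * U = 1 := mul_eq_one_comm.1 hUU
  have hspec : S = U * diagonal hH.eigenvalues * Uᵀ := by
    have := hH.spectral_theorem
    rw [Unitary.conjStarAlgAut_apply] at this
    simpa [star_eq_conjTranspose] using this
  have hUinv : U⁻¹ = Uᵀ := inv_eq_right_inv hUU
  have hexp : (NormedSpace.exp S).trace = ∑ i, Real.exp (hH.eigenvalues i) := by
    conv_lhs => rw [hspec, ← hUinv, exp_conj _ _ (IsUnit.of_mul_eq_one _ hUU), hUinv,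
      exp_diagonal, trace_mul_comm, ← Matrix.mul_assoc, hUU', Matrix.one_mul, trace_diagonal]
    simp [Real.exp_eq_exp_ℝ]
  set w := Uᵀ *ᵥ v with hw
  have hww : ∑ i, w i ^ 2 = 1 := by
    have : w ⬝ᵥ w = v ⬝ᵥ v := by
      rw [hw, dotProduct_mulVec, vecMul_transpose, mulVec_mulVec, hUU, one_mulVec]
    rw [← hv, ← this]; simp [dotProduct, pow_two]
  have hvS : v ⬝ᵥ S *ᵥ v = ∑ i, w i ^ 2 * hH.eigenvalues i := by
    conv_lhs => rw [hspec, ← mulVec_mulVec, ← mulVec_mulVec, dotProduct_mulVec,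
      ← mulVec_transpose, ← hw]
    simp only [dotProduct, mulVec_diagonal]
    exact Finset.sum_congr rfl fun i _ => by ring
  have hle : ∀ i, w i ^ 2 ≤ 1 := fun i => by
    rw [← hww]; exact Finset.single_le_sum (fun j _ => sq_nonneg (w j)) (Finset.mem_univ i)
  rw [hvS, hexp]
  calc Real.exp (∑ i, w i ^ 2 * hH.eigenvalues i)
      ≤ ∑ i, w i ^ 2 * Real.exp (hH.eigenvalues i) := by
        have := convexOn_exp.map_sum_le (t := Finset.univ) (w := fun i => w i ^ 2)
          (p := hH.eigenvalues) (fun i _ => sq_nonneg _) hww (fun i _ => Set.mem_univ _)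
        simpa using this
    _ ≤ _ := Finset.sum_le_sum fun i _ =>
        mul_le_of_le_one_left (Real.exp_nonneg _) (hle i)

end GoldenThompson

section RandomAccess

variable {ι κ : Type*} [Fintype ι] [DecidableEq ι] [Fintype κ] [DecidableEq κ] {n : ℕ}

omit [Fintype ι] [DecidableEq ι] in
theorem Matrix.isSymm_conj_diagonal (V : Matrix κ ι ℝ) (y : κ → ℝ) :
    (Vᵀ * diagonal y * V).IsSymm := by
  rw [IsSymm, transpose_mul, transpose_mul, transpose_transpose, diagonal_transpose,
    Matrix.mul_assoc]

theorem Finset.sum_update_not_add {β : Type*} [AddCommMonoid β] (F : (Fin n → Bool) → β)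
    (i : Fin n) :
    ∑ x, F (Function.update x i (!x i)) = ∑ x, F x := by
  have hinv : Function.Involutive
      (fun x : Fin n → Bool => Function.update x i (!x i)) := fun x => by simp
  exact (Equiv.sum_comp hinv.toPerm F)

theorem Matrix.sum_trace_exp_sum_le [Nonempty ι] (V : Fin n → Matrix κ ι ℝ)
    (hV : ∀ i, (V i)ᵀ * V i = 1) (y : Fin n → Bool → κ → ℝ)
    (hy : ∀ i k, Real.exp (y i true k) + Real.exp (y i false k) = 2) (s : Finset (Fin n)) :
    ∑ x : Fin n → Bool,
        (NormedSpace.exp (∑ i ∈ s, (V i)ᵀ * diagonal (y i (x i)) * V i)).trace ≤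
      2 ^ n * Fintype.card ι := by
  induction s using Finset.induction_on with
  | empty => simp
  | insert i s his ih =>
    refine le_trans ?_ ih
    set S : (Fin n → Bool) → Matrix ι ι ℝ :=
      fun x => ∑ j ∈ s, (V j)ᵀ * diagonal (y j (x j)) * V j with hS
    set F : (Fin n → Bool) → ℝ := fun x =>
      (NormedSpace.exp (∑ j ∈ insert i s, (V j)ᵀ * diagonal (y j (x j)) * V j)).trace with hF
    have hle : ∀ x, F x ≤ (NormedSpace.exp (S x) *
        ((V i)ᵀ * diagonal (fun k => Real.exp (y i (x i) k)) * V i)).trace := by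
      intro x
      simp only [hF, Finset.sum_insert his]
      rw [add_comm]
      refine trace_exp_add_le ?_ (V i) (hV i) (y i (x i))
      rw [IsSymm, transpose_sum]
      exact Finset.sum_congr rfl fun j _ => isSymm_conj_diagonal _ _
    have hflip : ∀ x, S (Function.update x i (!x i)) = S x := by
      intro x
      refine Finset.sum_congr rfl fun j hj => ?_
      rw [Function.update_of_ne (by rintro rfl; exact his hj)]
    have hpair : ∀ x, F x + F (Function.update x i (!x i)) ≤
        2 * (NormedSpace.exp (S x)).trace := by
      intro x
      have h1 := hle x
      have h2 := hle (Function.update x i (!x i))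
      rw [hflip, Function.update_self] at h2
      refine (add_le_add h1 h2).trans_eq ?_
      rw [← trace_add, ← Matrix.mul_add, ← Matrix.add_mul, ← Matrix.mul_add, diagonal_add]
      have : (fun k => Real.exp (y i (x i) k) + Real.exp (y i (!x i) k)) = fun _ => 2 := by
        ext k
        cases x i
        · rw [add_comm]; exact hy i k
        · exact hy i k
      rw [this]
      have hd : diagonal (fun _ : κ => (2 : ℝ)) = (2 : ℝ) • 1 := by
        rw [smul_one_eq_diagonal]
      rw [hd, Matrix.mul_smul, Matrix.mul_one, Matrix.smul_mul, hV, Matrix.mul_smul,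
        Matrix.mul_one, trace_smul, smul_eq_mul]
    have h := Finset.sum_le_sum fun x (_ : x ∈ Finset.univ) => hpair x
    rw [Finset.sum_add_distrib, Finset.sum_update_not_add F i, ← Finset.mul_sum] at h
    linarith

theorem Matrix.exp_mul_le_card_of_isometry [Nonempty ι] (V : Fin n → Matrix κ ι ℝ)
    (hV : ∀ i, (V i)ᵀ * V i = 1) (y : Fin n → Bool → κ → ℝ)
    (hy : ∀ i k, Real.exp (y i true k) + Real.exp (y i false k) = 2)
    (v : (Fin n → Bool) → ι → ℝ) (hv : ∀ x, v x ⬝ᵥ v x = 1) (τ : ℝ)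
    (hτ : ∀ x i, τ ≤ ∑ k, y i (x i) k * (V i *ᵥ v x) k ^ 2) :
    Real.exp (n * τ) ≤ Fintype.card ι := by
  have h := sum_trace_exp_sum_le V hV y hy Finset.univ
  have hx : ∀ x : Fin n → Bool, Real.exp (n * τ) ≤
      (NormedSpace.exp (∑ i, (V i)ᵀ * diagonal (y i (x i)) * V i)).trace := by
    intro x
    refine le_trans (Real.exp_le_exp.2 ?_) (exp_dotProduct_le_trace_exp ?_ (hv x))
    · rw [sum_mulVec, dotProduct_sum]
      calc (n : ℝ) * τ = ∑ _i : Fin n, τ := by simp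
        _ ≤ _ := Finset.sum_le_sum fun i _ => (hτ x i).trans_eq ?_
      rw [← mulVec_mulVec, ← mulVec_mulVec, dotProduct_mulVec, vecMul_transpose]
      simp only [dotProduct, mulVec_diagonal]
      exact Finset.sum_congr rfl fun k _ => by ring
    · rw [IsSymm, transpose_sum]
      exact Finset.sum_congr rfl fun j _ => isSymm_conj_diagonal _ _
  have h2 := (Finset.sum_le_sum fun x (_ : x ∈ Finset.univ) => hx x).trans h
  simp only [Finset.sum_const, Finset.card_univ, Fintype.card_fun, Fintype.card_bool,
    Fintype.card_fin, nsmul_eq_mul, Nat.cast_pow, Nat.cast_ofNat] at h2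
  exact le_of_mul_le_mul_left h2 (by positivity)

theorem Matrix.exp_mul_le_card [Nonempty ι] (V : Fin n → Matrix κ ι ℝ)
    (w : Fin n → ι → ℝ) (hV : ∀ i, (V i)ᵀ * V i = diagonal (w i)) (hw : ∀ i d, w i d ≤ 1)
    (y : Fin n → Bool → κ → ℝ)
    (hy : ∀ i k, Real.exp (y i true k) + Real.exp (y i false k) = 2)
    (v : (Fin n → Bool) → ι → ℝ) (hv : ∀ x, v x ⬝ᵥ v x = 1) (τ : ℝ)
    (hτ : ∀ x i, τ ≤ ∑ k, y i (x i) k * (V i *ᵥ v x) k ^ 2) :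
    Real.exp (n * τ) ≤ Fintype.card ι := by
  refine exp_mul_le_card_of_isometry
    (fun i => fromRows (V i) (diagonal fun d => √(1 - w i d))) (fun i => ?_)
    (fun i s => Sum.elim (y i s) 0) (fun i k => ?_) v hv τ (fun x i => ?_)
  · rw [transpose_fromRows, fromCols_mul_fromRows, hV, diagonal_transpose, diagonal_mul_diagonal,
      diagonal_add, ← diagonal_one]
    congr 1
    ext d
    rw [Real.mul_self_sqrt (sub_nonneg.2 (hw i d))]
    ring
  · cases k with
    | inl k => exact hy i k
    | inr d => norm_num
  · simpa [fromRows_mulVec] using hτ x i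

end RandomAccess

section Characters

/-- The sign `(-1)^c` of a bit. -/
def bitSign (c : Bool) : ℝ := if c then -1 else 1

@[simp] theorem bitSign_true : bitSign true = -1 := rfl

@[simp] theorem bitSign_false : bitSign false = 1 := rfl

theorem bitSign_mul_self (c : Bool) : bitSign c * bitSign c = 1 := by cases c <;> simp

variable {ℓ : ℕ}

/-- The character of `{0,1}^ℓ` indexed by `T`. -/
def parityChar (T : Finset (Fin ℓ)) (a : Fin ℓ → Bool) : ℝ := ∏ k ∈ T, bitSign (a k)

theorem parityChar_mul_self (T : Finset (Fin ℓ)) (a : Fin ℓ → Bool) :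
    parityChar T a * parityChar T a = 1 := by
  rw [parityChar, ← Finset.prod_mul_distrib]
  exact Finset.prod_eq_one fun k _ => bitSign_mul_self _

theorem sum_parityChar_mul (T T' : Finset (Fin ℓ)) :
    ∑ a, parityChar T a * parityChar T' a = if T = T' then 2 ^ ℓ else 0 := by
  have h : ∀ a : Fin ℓ → Bool, parityChar T a * parityChar T' a =
      ∏ k, (if k ∈ T then bitSign (a k) else 1) * (if k ∈ T' then bitSign (a k) else 1) := by
    intro a
    rw [Finset.prod_mul_distrib, Finset.prod_ite_mem, Finset.prod_ite_mem, Finset.univ_inter,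
      Finset.univ_inter, parityChar, parityChar]
  simp_rw [h]
  rw [← Fintype.piFinset_univ, ← Finset.prod_univ_sum (fun _ => Finset.univ)
    (fun k c => (if k ∈ T then bitSign c else 1) * (if k ∈ T' then bitSign c else 1))]
  split_ifs with hT
  · subst hT
    calc _ = ∏ _k : Fin ℓ, (2 : ℝ) := Finset.prod_congr rfl fun k _ => by
          by_cases hk : k ∈ T <;> (simp [hk]; try norm_num)
      _ = _ := by simp
  · obtain ⟨k, hk⟩ : ∃ k, ¬(k ∈ T ↔ k ∈ T') := by
      by_contra! hcon; exact hT (Finset.ext hcon)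
    refine Finset.prod_eq_zero (Finset.mem_univ k) ?_
    by_cases h1 : k ∈ T <;> by_cases h2 : k ∈ T' <;> simp_all

/-- The reproducing kernel of the characters supported in `S`; it is `2 ^ #S` times the indicator
of agreement on `S`. -/
def agreeKernel (S : Finset (Fin ℓ)) (A a : Fin ℓ → Bool) : ℝ :=
  ∑ T ∈ S.powerset, parityChar T a * parityChar T A

theorem agreeKernel_eq_prod (S : Finset (Fin ℓ)) (A a : Fin ℓ → Bool) :
    agreeKernel S A a = ∏ k ∈ S, (1 + bitSign (a k) * bitSign (A k)) := by
  rw [Finset.prod_one_add, agreeKernel]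
  exact Finset.sum_congr rfl fun T _ => by rw [Finset.prod_mul_distrib]; rfl

theorem agreeKernel_sq (S : Finset (Fin ℓ)) (A a : Fin ℓ → Bool) :
    agreeKernel S A a ^ 2 = 2 ^ S.card * agreeKernel S A a := by
  rw [agreeKernel_eq_prod, ← Finset.prod_pow, ← Finset.prod_const, ← Finset.prod_mul_distrib]
  refine Finset.prod_congr rfl fun k _ => ?_
  cases a k <;> cases A k <;> norm_num

theorem eq_of_agreeKernel_ne_zero {S : Finset (Fin ℓ)} {A a : Fin ℓ → Bool}
    (h : agreeKernel S A a ≠ 0) : ∀ k ∈ S, a k = A k := by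
  rw [agreeKernel_eq_prod, Finset.prod_ne_zero_iff] at h
  intro k hk
  have := h k hk
  revert this
  cases a k <;> cases A k <;> simp

theorem sum_agreeKernel (S : Finset (Fin ℓ)) (A : Fin ℓ → Bool) :
    ∑ a, agreeKernel S A a = 2 ^ ℓ := by
  simp only [agreeKernel]
  rw [Finset.sum_comm]
  have h : ∀ T : Finset (Fin ℓ), ∑ a, parityChar T a * parityChar T A =
      if T = ∅ then 2 ^ ℓ else 0 := by
    intro T
    have h0 := sum_parityChar_mul T ∅
    have h1 : ∀ a : Fin ℓ → Bool, parityChar ∅ a = 1 := fun a => by simp [parityChar]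
    simp only [h1, mul_one] at h0
    rw [← Finset.sum_mul, h0]
    split_ifs with hT
    · rw [hT, h1, mul_one]
    · rw [zero_mul]
  rw [Finset.sum_congr rfl fun T _ => h T]
  simp

theorem sum_agreeKernel_sq (S : Finset (Fin ℓ)) (A : Fin ℓ → Bool) :
    ∑ a, agreeKernel S A a ^ 2 = 2 ^ S.card * 2 ^ ℓ := by
  simp_rw [agreeKernel_sq]
  rw [← Finset.mul_sum, sum_agreeKernel]

theorem card_subtype_card_le (ℓ b : ℕ) :
    Fintype.card {T : Finset (Fin ℓ) // T.card ≤ b} =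
      ∑ i ∈ Finset.range (b + 1), ℓ.choose i := by
  have e : (Finset.univ.filter fun T : Finset (Fin ℓ) => T.card ≤ b) =
      (Finset.range (b + 1)).biUnion fun i => Finset.powersetCard i Finset.univ := by
    ext T
    simp [Finset.mem_powersetCard]
  rw [Fintype.card_subtype, e, Finset.card_biUnion]
  · simp
  · intro i _ j _ hij
    exact Finset.pairwise_disjoint_powersetCard _ hij

theorem sum_subtype_card_le_ite {b : ℕ} {S : Finset (Fin ℓ)} (hS : S.card ≤ b)
    (F : Finset (Fin ℓ) → ℝ) :
    ∑ T : {T : Finset (Fin ℓ) // T.card ≤ b}, (if T.1 ⊆ S then F T.1 else 0) =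
      ∑ T ∈ S.powerset, F T := by
  rw [← Finset.sum_filter]
  refine Finset.sum_bij (fun T _ => T.1) (fun T hT => ?_) (fun T _ T' _ h => Subtype.ext h)
    (fun T hT => ?_) (fun T _ => rfl)
  · simpa using hT
  · rw [Finset.mem_powerset] at hT
    exact ⟨⟨T, (Finset.card_le_card hT).trans hS⟩, by simpa using hT, rfl⟩

end Characters

section Measurement

variable {ρ Q : Type*} [Fintype ρ] [Fintype Q] [DecidableEq Q] {ℓ b : ℕ}

/-- Index set of the encoding: a server, a query, and a character of degree at most `b`. -/
abbrev EncodingIndex (Q : Type*) (ℓ b : ℕ) := Bool × Q × {T : Finset (Fin ℓ) // T.card ≤ b}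

/-- Index set of the measurement outcomes: the user's randomness, a guess for each of the two
answers, and a sign. -/
abbrev OutcomeIndex (ρ : Type*) (ℓ : ℕ) := ρ × ((Fin ℓ → Bool) × (Fin ℓ → Bool)) × Bool

/-- The amplitude with which an outcome with randomness `r` sees an index of the encoding. -/
noncomputable def measurementCoeff (ω : ρ → ℝ) (μ : Bool → Q → ℝ) (q : Bool → ρ → Q)
    (S : Bool → ρ → Finset (Fin ℓ)) (r : ρ) (d : EncodingIndex Q ℓ b) : ℝ :=
  if q d.1 r = d.2.1 ∧ d.2.2.1 ⊆ S d.1 r then √(ω r / 2) / 2 ^ ℓ / √(μ d.1 d.2.1) else 0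

/-- The character part of a measurement vector. -/
def measurementSign (j : Bool) (T : Finset (Fin ℓ)) (p : (Fin ℓ → Bool) × (Fin ℓ → Bool))
    (c : Bool) : ℝ :=
  bif j then parityChar T p.2 * bitSign c else parityChar T p.1

/-- The matrix whose rows are the (rank one) measurement vectors. -/
noncomputable def measurementMatrix (b : ℕ) (ω : ρ → ℝ) (μ : Bool → Q → ℝ) (q : Bool → ρ → Q)
    (S : Bool → ρ → Finset (Fin ℓ)) : Matrix (OutcomeIndex ρ ℓ) (EncodingIndex Q ℓ b) ℝ :=
  of fun k d => measurementCoeff ω μ q S k.1 d * measurementSign d.1 d.2.2.1 k.2.1 k.2.2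

/-- The unit vector encoding the answers `A` of the two servers to all queries. -/
noncomputable def encodingVector (b : ℕ) (μ : Bool → Q → ℝ) (u : ℝ)
    (A : Bool → Q → Fin ℓ → Bool) (d : EncodingIndex Q ℓ b) : ℝ :=
  √(μ d.1 d.2.1) / √(2 * u) * parityChar d.2.2.1 (A d.1 d.2.1)

theorem sum_measurementSign_mul (j j' : Bool) (T T' : Finset (Fin ℓ)) :
    ∑ p, ∑ c, measurementSign j T p c * measurementSign j' T' p c =
      if j = j' ∧ T = T' then 2 * (2 ^ ℓ) ^ 2 else 0 := by
  have h := sum_parityChar_mul T T'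
  have hc : (Finset.univ : Finset (Fin ℓ → Bool)).card = 2 ^ ℓ := by simp
  cases j <;> cases j' <;>
    simp only [measurementSign, Fintype.sum_bool, cond_true, cond_false, bitSign_true,
      bitSign_false, Bool.true_eq_false, Bool.false_eq_true, false_and, if_false, true_and]
  · calc _ = ∑ p : (Fin ℓ → Bool) × (Fin ℓ → Bool),
          2 * (parityChar T p.1 * parityChar T' p.1) :=
          Finset.sum_congr rfl fun p _ => by ring
      _ = ∑ _a' : Fin ℓ → Bool, 2 * ∑ a, parityChar T a * parityChar T' a := by
          rw [Fintype.sum_prod_type_right]; simp only [Finset.mul_sum]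
      _ = _ := by
          rw [Finset.sum_const, hc, h, nsmul_eq_mul]; push_cast; split_ifs <;> ring
  · exact Finset.sum_eq_zero fun p _ => by ring
  · exact Finset.sum_eq_zero fun p _ => by ring
  · calc _ = ∑ p : (Fin ℓ → Bool) × (Fin ℓ → Bool),
          2 * (parityChar T p.2 * parityChar T' p.2) :=
          Finset.sum_congr rfl fun p _ => by ring
      _ = ∑ _a : Fin ℓ → Bool, 2 * ∑ a', parityChar T a' * parityChar T' a' := by
          rw [Fintype.sum_prod_type]; simp only [Finset.mul_sum]
      _ = _ := by
          rw [Finset.sum_const, hc, h, nsmul_eq_mul]; push_cast; split_ifs <;> ring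

variable {ω : ρ → ℝ} {μ : Bool → Q → ℝ} {q : Bool → ρ → Q} {S : Bool → ρ → Finset (Fin ℓ)}

omit [Fintype Q] in
theorem measurementMatrix_gram (hω : ∀ r, 0 ≤ ω r) (hμ : ∀ j x, 0 ≤ μ j x) :
    (measurementMatrix b ω μ q S)ᵀ * measurementMatrix b ω μ q S =
      diagonal fun d => ∑ r, if q d.1 r = d.2.1 ∧ d.2.2.1 ⊆ S d.1 r then
        ω r / μ d.1 d.2.1 else 0 := by
  ext d d'
  have h : ((measurementMatrix b ω μ q S)ᵀ * measurementMatrix b ω μ q S) d d' =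
      ∑ r, measurementCoeff ω μ q S r d * measurementCoeff ω μ q S r d' *
        (if d.1 = d'.1 ∧ d.2.2.1 = d'.2.2.1 then 2 * (2 ^ ℓ) ^ 2 else 0) := by
    rw [mul_apply, Fintype.sum_prod_type]
    refine Finset.sum_congr rfl fun r _ => ?_
    rw [← sum_measurementSign_mul, Fintype.sum_prod_type, Finset.mul_sum]
    refine Finset.sum_congr rfl fun p _ => ?_
    rw [Finset.mul_sum]
    refine Finset.sum_congr rfl fun c _ => ?_
    simp only [transpose_apply, measurementMatrix, of_apply]
    ring
  rw [h]
  by_cases hd : d = d'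
  · subst hd
    rw [diagonal_apply_eq]
    refine Finset.sum_congr rfl fun r _ => ?_
    simp only [measurementCoeff, and_self, if_true]
    split_ifs
    · have h1 : √(ω r / 2) * √(ω r / 2) = ω r / 2 := Real.mul_self_sqrt (by linarith [hω r])
      have h2 : √(μ d.1 d.2.1) * √(μ d.1 d.2.1) = μ d.1 d.2.1 := Real.mul_self_sqrt (hμ _ _)
      calc _ = (√(ω r / 2) * √(ω r / 2)) / (√(μ d.1 d.2.1) * √(μ d.1 d.2.1)) *
            (2 * ((2 ^ ℓ) ^ 2 / (2 ^ ℓ) ^ 2)) := by ring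
        _ = _ := by rw [h1, h2, div_self (by positivity)]; ring
    · ring
  · rw [diagonal_apply_ne _ hd]
    refine Finset.sum_eq_zero fun r _ => ?_
    split_ifs with hjT
    · have : d.2.1 ≠ d'.2.1 := fun hq =>
        hd (Prod.ext hjT.1 (Prod.ext hq (Subtype.ext hjT.2)))
      simp only [measurementCoeff]
      rw [← hjT.1]
      by_cases h1 : q d.1 r = d.2.1
      · rw [if_neg (c := q d.1 r = d'.2.1 ∧ _) (fun h' => this (h1.symm.trans h'.1))]; ring
      · rw [if_neg (fun h' => h1 h'.1)]; ring
    · ring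

omit [DecidableEq Q] in
theorem encodingVector_dotProduct_self (hμ : ∀ j x, 0 ≤ μ j x) (hμ1 : ∀ j, ∑ x, μ j x = 1)
    {u : ℕ} (hu : u = ∑ i ∈ Finset.range (b + 1), ℓ.choose i) (hu0 : 0 < u)
    (A : Bool → Q → Fin ℓ → Bool) :
    encodingVector b μ u A ⬝ᵥ encodingVector b μ u A = 1 := by
  have hu' : (0 : ℝ) < u := by exact_mod_cast hu0
  have h : ∀ d : EncodingIndex Q ℓ b,
      encodingVector b μ u A d * encodingVector b μ u A d = μ d.1 d.2.1 / (2 * u) := by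
    intro d
    have h1 : √(2 * (u : ℝ)) * √(2 * u) = 2 * u := Real.mul_self_sqrt (by positivity)
    have h2 : √(μ d.1 d.2.1) * √(μ d.1 d.2.1) = μ d.1 d.2.1 := Real.mul_self_sqrt (hμ _ _)
    calc _ = (√(μ d.1 d.2.1) * √(μ d.1 d.2.1)) / (√(2 * (u : ℝ)) * √(2 * u)) *
          (parityChar d.2.2.1 (A d.1 d.2.1) * parityChar d.2.2.1 (A d.1 d.2.1)) := by
          rw [encodingVector]; ring
      _ = _ := by rw [h1, h2, parityChar_mul_self, mul_one]
  rw [dotProduct, Finset.sum_congr rfl fun d _ => h d, Fintype.sum_prod_type]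
  simp only [Fintype.sum_prod_type, Finset.sum_const, Finset.card_univ, card_subtype_card_le,
    ← hu, nsmul_eq_mul, ← Finset.mul_sum, ← Finset.sum_div, hμ1, Fintype.card_bool]
  push_cast
  field_simp

omit [Fintype ρ] in
theorem measurementMatrix_mulVec (hμ : ∀ j x, 0 ≤ μ j x)
    (hμω : ∀ j r, μ j (q j r) = 0 → ω r = 0) (hS : ∀ j r, (S j r).card ≤ b)
    (u : ℝ) (A : Bool → Q → Fin ℓ → Bool) (r : ρ) (p : (Fin ℓ → Bool) × (Fin ℓ → Bool))
    (c : Bool) :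
    (measurementMatrix b ω μ q S *ᵥ encodingVector b μ u A) (r, p, c) =
      √(ω r / 2) / 2 ^ ℓ / √(2 * u) *
        (agreeKernel (S false r) (A false (q false r)) p.1 +
          bitSign c * agreeKernel (S true r) (A true (q true r)) p.2) := by
  have key : ∀ j, ∑ x : Q × {T : Finset (Fin ℓ) // T.card ≤ b},
      measurementMatrix b ω μ q S (r, p, c) (j, x) * encodingVector b μ u A (j, x) =
      √(ω r / 2) / 2 ^ ℓ / √(2 * u) * (bif j then bitSign c else 1) *
        agreeKernel (S j r) (A j (q j r)) (bif j then p.2 else p.1) := by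
    intro j
    rw [Fintype.sum_prod_type, Finset.sum_eq_single (q j r)]
    · rw [agreeKernel, ← sum_subtype_card_le_ite (hS j r), Finset.mul_sum]
      refine Finset.sum_congr rfl fun T _ => ?_
      simp only [measurementMatrix, of_apply, measurementCoeff, encodingVector, true_and]
      split_ifs
      · have hcancel : √(ω r / 2) / √(μ j (q j r)) * √(μ j (q j r)) = √(ω r / 2) := by
          by_cases h0 : μ j (q j r) = 0
          · simp [hμω j r h0]
          · rw [div_mul_cancel₀]
            exact (Real.sqrt_pos.2 (lt_of_le_of_ne (hμ _ _) (Ne.symm h0))).ne'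
        conv_rhs => rw [← hcancel]
        cases j <;> simp only [measurementSign, cond_true, cond_false] <;> ring
      · ring
    · intro x _ hx
      refine Finset.sum_eq_zero fun T _ => ?_
      simp only [measurementMatrix, of_apply, measurementCoeff]
      rw [if_neg (fun h => hx h.1.symm)]
      ring
    · simp
  rw [mulVec, dotProduct, Fintype.sum_prod_type, Fintype.sum_bool, key, key]
  simp only [cond_true, cond_false]
  ring

theorem sum_outcome_mul_sq (hω : ∀ r, 0 ≤ ω r) (hμ : ∀ j x, 0 ≤ μ j x)
    (hμω : ∀ j r, μ j (q j r) = 0 → ω r = 0) (hS : ∀ j r, (S j r).card = b)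
    {u : ℝ} (hu : 0 < u) (A : Bool → Q → Fin ℓ → Bool)
    (g : ρ → (Fin ℓ → Bool) × (Fin ℓ → Bool) → ℝ)
    (hg : ∀ r a a' e e', (∀ k ∈ S false r, a k = e k) → (∀ k ∈ S true r, a' k = e' k) →
      g r (a, a') = g r (e, e')) (lam m : ℝ) :
    ∑ k : OutcomeIndex ρ ℓ, (lam * (bitSign k.2.2 * g k.1 k.2.1) - m) *
        (measurementMatrix b ω μ q S *ᵥ encodingVector b μ u A) k ^ 2 =
      (lam * ∑ r, ω r * g r (A false (q false r), A true (q true r)) -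
        m * 2 ^ b * ∑ r, ω r) / u := by
  rw [Fintype.sum_prod_type, Finset.mul_sum, Finset.mul_sum, ← Finset.sum_sub_distrib,
    Finset.sum_div]
  refine Finset.sum_congr rfl fun r _ => ?_
  set G := agreeKernel (S false r) (A false (q false r)) with hG
  set G' := agreeKernel (S true r) (A true (q true r)) with hG'
  set γ := g r (A false (q false r), A true (q true r)) with hγ
  have hgG : ∀ p : (Fin ℓ → Bool) × (Fin ℓ → Bool),
      g r p * (G p.1 * G' p.2) = γ * (G p.1 * G' p.2) := by
    intro p
    by_cases h1 : G p.1 = 0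
    · rw [h1]; ring
    by_cases h2 : G' p.2 = 0
    · rw [h2]; ring
    rw [hγ, ← hg r p.1 p.2 _ _ (eq_of_agreeKernel_ne_zero h1) (eq_of_agreeKernel_ne_zero h2)]
  have hsq : (√(ω r / 2) / 2 ^ ℓ / √(2 * u)) ^ 2 = ω r / (4 * u) / (2 ^ ℓ) ^ 2 := by
    rw [div_pow, div_pow, Real.sq_sqrt (by linarith [hω r]), Real.sq_sqrt (by positivity)]
    field_simp
    ring
  have hc : (Finset.univ : Finset (Fin ℓ → Bool)).card = 2 ^ ℓ := by simp
  have s1 : ∑ p : (Fin ℓ → Bool) × (Fin ℓ → Bool), G p.1 * G' p.2 = (2 ^ ℓ) ^ 2 := by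
    rw [Fintype.sum_prod_type]
    simp only [← Finset.mul_sum, ← Finset.sum_mul, hG, hG', sum_agreeKernel]
    ring
  have s2 : ∑ p : (Fin ℓ → Bool) × (Fin ℓ → Bool), (G p.1 ^ 2 + G' p.2 ^ 2) =
      2 * 2 ^ b * (2 ^ ℓ) ^ 2 := by
    rw [Finset.sum_add_distrib, Fintype.sum_prod_type, Fintype.sum_prod_type_right]
    simp only [Finset.sum_const, hc, ← Finset.smul_sum, hG, hG', sum_agreeKernel_sq, hS]
    simp only [nsmul_eq_mul]
    push_cast
    ring
  rw [Fintype.sum_prod_type]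
  calc _ = ∑ p : (Fin ℓ → Bool) × (Fin ℓ → Bool), ω r / (4 * u) / (2 ^ ℓ) ^ 2 *
        (4 * lam * γ * (G p.1 * G' p.2) - 2 * m * (G p.1 ^ 2 + G' p.2 ^ 2)) := by
        refine Finset.sum_congr rfl fun p _ => ?_
        have e := hgG p
        simp only [Fintype.sum_bool]
        rw [measurementMatrix_mulVec hμ hμω (fun j r => (hS j r).le),
          measurementMatrix_mulVec hμ hμω (fun j r => (hS j r).le), mul_pow, mul_pow, hsq,
          ← hG, ← hG', bitSign_true, bitSign_false]
        linear_combination (4 * lam * (ω r / (4 * u) / (2 ^ ℓ) ^ 2)) * e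
    _ = ω r / (4 * u) / (2 ^ ℓ) ^ 2 *
        (4 * lam * γ * (2 ^ ℓ) ^ 2 - 2 * m * (2 * 2 ^ b * (2 ^ ℓ) ^ 2)) := by
        rw [← Finset.mul_sum, Finset.sum_sub_distrib, ← Finset.mul_sum, ← Finset.mul_sum, s1, s2]
    _ = _ := by field_simp; ring

/-- The lower bound on the dimension of the encoding, for a family of subnormalised reweightings
`ω i` of the user's randomness whose query marginals are dominated by `μ`. -/
theorem exp_mul_le_of_biased_decoding [Nonempty Q] {n : ℕ} {ω : Fin n → ρ → ℝ}
    {q : Bool → Fin n → ρ → Q} {S : Bool → Fin n → ρ → Finset (Fin ℓ)}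
    (hω : ∀ i r, 0 ≤ ω i r) (hω1 : ∀ i, ∑ r, ω i r ≤ 1)
    (hμ : ∀ j x, 0 ≤ μ j x) (hμ1 : ∀ j, ∑ x, μ j x = 1)
    (hωμ : ∀ j i x, ∑ r, (if q j i r = x then ω i r else 0) ≤ μ j x)
    (hS : ∀ j i r, (S j i r).card = b)
    {u : ℕ} (hu : u = ∑ i ∈ Finset.range (b + 1), ℓ.choose i)
    (A : (Fin n → Bool) → Bool → Q → Fin ℓ → Bool)
    (f : Fin n → ρ → (Fin ℓ → Bool) → (Fin ℓ → Bool) → Bool)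
    (hf : ∀ i r a a' e e', (∀ k ∈ S false i r, a k = e k) → (∀ k ∈ S true i r, a' k = e' k) →
      f i r a a' = f i r e e')
    {B : ℝ} (hB : ∀ x i, B ≤ ∑ r, ω i r *
      (bitSign (f i r (A x false (q false i r)) (A x true (q true i r))) * bitSign (x i)))
    {θ : ℝ} (hθ0 : 0 ≤ θ) (hθ1 : θ < 1) :
    Real.exp (n * (((Real.log (1 + θ) - Real.log (1 - θ)) / 2 * B +
      (Real.log (1 + θ) + Real.log (1 - θ)) / 2 * 2 ^ b) / u)) ≤ 2 * Fintype.card Q * u := by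
  classical
  have hu0 : 0 < u := by
    rw [hu]
    exact Finset.sum_pos' (fun _ _ => Nat.zero_le _) ⟨0, by simp, by simp⟩
  have hu' : (0 : ℝ) < u := by exact_mod_cast hu0
  set lam := (Real.log (1 + θ) - Real.log (1 - θ)) / 2 with hlam
  set m := -((Real.log (1 + θ) + Real.log (1 - θ)) / 2) with hm
  have hlam0 : 0 ≤ lam := by
    have := Real.log_le_log (by linarith : 0 < 1 - θ) (by linarith : 1 - θ ≤ 1 + θ)
    rw [hlam]; linarith
  have hm0 : 0 ≤ m := by
    have : Real.log (1 + θ) + Real.log (1 - θ) ≤ 0 := by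
      rw [← Real.log_mul (by linarith) (by linarith)]
      exact Real.log_nonpos (by nlinarith) (by nlinarith)
    rw [hm]; linarith
  have hlog : ∀ z : ℝ, z = 1 ∨ z = -1 → Real.exp (lam * z - m) = 1 + θ * z := by
    rintro z (rfl | rfl)
    · have : lam * 1 - m = Real.log (1 + θ) := by rw [hlam, hm]; ring
      rw [this, Real.exp_log (by linarith)]; ring
    · have : lam * (-1) - m = Real.log (1 - θ) := by rw [hlam, hm]; ring
      rw [this, Real.exp_log (by linarith)]; ring
  have hμω : ∀ i j r, μ j (q j i r) = 0 → ω i r = 0 := by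
    intro i j r h
    have h1 := hωμ j i (q j i r)
    rw [h] at h1
    have h2 := Finset.single_le_sum (f := fun s => if q j i s = q j i r then ω i s else 0)
      (fun s _ => by split_ifs; exacts [hω i s, le_rfl]) (Finset.mem_univ r)
    simp only [if_true] at h2
    exact le_antisymm (h2.trans h1) (hω i r)
  have hne : Nonempty (EncodingIndex Q ℓ b) := ⟨(true, Classical.arbitrary Q, ⟨∅, by simp⟩)⟩
  have hcard : Fintype.card (EncodingIndex Q ℓ b) = 2 * (Fintype.card Q * u) := by
    rw [Fintype.card_prod, Fintype.card_prod, card_subtype_card_le, ← hu, Fintype.card_bool]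
  have main := exp_mul_le_card
    (fun i => measurementMatrix b (ω i) μ (fun j => q j i) (fun j => S j i)) _
    (fun i => measurementMatrix_gram (hω i) hμ) (fun i d => ?_)
    (fun i s k => lam * (bitSign k.2.2 * (bitSign (f i k.1 k.2.1.1 k.2.1.2) * bitSign s)) - m)
    (fun i k => ?_) (fun x => encodingVector b μ u (A x))
    (fun x => encodingVector_dotProduct_self hμ hμ1 hu hu0 (A x))
    ((lam * B - m * 2 ^ b) / u) (fun x i => ?_)
  · rw [hcard] at main
    push_cast at main
    calc _ = Real.exp (n * ((lam * B - m * 2 ^ b) / u)) := by rw [hm]; ring_nf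
      _ ≤ _ := main.trans_eq (by ring)
  · calc _ ≤ ∑ r, (if q d.1 i r = d.2.1 then ω i r else 0) / μ d.1 d.2.1 := by
          refine Finset.sum_le_sum fun r _ => ?_
          have h0 : 0 ≤ ω i r / μ d.1 d.2.1 := div_nonneg (hω i r) (hμ _ _)
          by_cases h1 : q d.1 i r = d.2.1
          · rw [if_pos h1]
            split_ifs
            exacts [le_rfl, h0]
          · rw [if_neg (fun h => h1 h.1), if_neg h1, zero_div]
      _ ≤ 1 := by
          rw [← Finset.sum_div]
          exact div_le_one_of_le₀ (hωμ _ _ _) (hμ _ _)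
  · have h1 : ∀ s, bitSign k.2.2 * (bitSign (f i k.1 k.2.1.1 k.2.1.2) * bitSign s) = 1 ∨
        bitSign k.2.2 * (bitSign (f i k.1 k.2.1.1 k.2.1.2) * bitSign s) = -1 := by
      intro s
      cases k.2.2 <;> cases f i k.1 k.2.1.1 k.2.1.2 <;> cases s <;> simp
    rw [hlog _ (h1 true), hlog _ (h1 false), bitSign_true, bitSign_false]
    ring
  · have hval := sum_outcome_mul_sq (hω i) hμ (hμω i) (hS · i) hu' (A x)
      (fun r p => bitSign (f i r p.1 p.2) * bitSign (x i))
      (fun r a a' e e' h h' => by rw [hf i r a a' e e' h h']) lam m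
    rw [hval]
    have h1 := mul_le_mul_of_nonneg_left (hB x i) hlam0
    have h2 := mul_le_mul_of_nonneg_left (hω1 i) (by positivity : 0 ≤ m * 2 ^ b)
    refine div_le_div_of_nonneg_right ?_ hu'.le
    linarith

end Measurement

end

section PrivateRetrieval

theorem exists_weights_le_of_marginal {ρ Q : Type*} [Fintype ρ] [Fintype Q] [DecidableEq Q]
    {w : ρ → ℝ} (hw : ∀ r, 0 ≤ w r) (q : ρ → Q) {μ : Q → ℝ} (hμ : ∀ x, 0 ≤ μ x)
    (hsum : ∑ x, μ x = ∑ r, w r) :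
    ∃ ω : ρ → ℝ, (∀ r, 0 ≤ ω r) ∧ (∀ r, ω r ≤ w r) ∧
      (∀ x, ∑ r, (if q r = x then ω r else 0) ≤ μ x) ∧
      ∑ r, (w r - ω r) ≤ 1 / 2 * ∑ x, |μ x - ∑ r with q r = x, w r| := by
  set ν : Q → ℝ := fun x => ∑ r with q r = x, w r with hν
  have hν0 : ∀ x, 0 ≤ ν x := fun x => Finset.sum_nonneg fun r _ => hw r
  set c : Q → ℝ := fun x => min 1 (μ x / ν x) with hc
  have hc0 : ∀ x, 0 ≤ c x := fun x => le_min zero_le_one (div_nonneg (hμ x) (hν0 x))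
  have hνc : ∀ x, ν x * c x ≤ μ x ∧ ν x - ν x * c x ≤ (|μ x - ν x| + (ν x - μ x)) / 2 := by
    intro x
    rcases (hν0 x).eq_or_lt with h | h
    · rw [← h, zero_mul]
      exact ⟨hμ x, by linarith [le_abs_self (μ x - 0)]⟩
    · rw [hc, mul_min_of_nonneg _ _ h.le, mul_one, mul_div_cancel₀ _ h.ne']
      refine ⟨min_le_right _ _, ?_⟩
      rcases le_total (ν x) (μ x) with h' | h'
      · rw [min_eq_left h']; linarith [le_abs_self (μ x - ν x)]
      · rw [min_eq_right h']; linarith [neg_le_abs (μ x - ν x)]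
  have hfib : ∀ g : ρ → ℝ, ∑ r, g r = ∑ x, ∑ r with q r = x, g r := fun g =>
    (Finset.sum_fiberwise _ _ _).symm
  have hwc : ∀ x, ∑ r with q r = x, w r * c (q r) = ν x * c x := fun x => by
    rw [hν, Finset.sum_mul]
    exact Finset.sum_congr rfl fun r hr => by rw [(Finset.mem_filter.1 hr).2]
  refine ⟨fun r => w r * c (q r), fun r => mul_nonneg (hw r) (hc0 _),
    fun r => mul_le_of_le_one_right (hw r) (min_le_left _ _), fun x => ?_, ?_⟩
  · rw [← Finset.sum_filter, hwc]
    exact (hνc x).1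
  · rw [Finset.sum_sub_distrib, hfib w, hfib fun r => w r * c (q r), ← Finset.sum_sub_distrib]
    calc _ = ∑ x, (ν x - ν x * c x) := Finset.sum_congr rfl fun x _ => by rw [hwc]
      _ ≤ ∑ x, (|μ x - ν x| + (ν x - μ x)) / 2 := Finset.sum_le_sum fun x _ => (hνc x).2
      _ = _ := by
        rw [← Finset.sum_div, Finset.sum_add_distrib, Finset.sum_sub_distrib, hsum, hfib w]
        ring

/-- The weights of the randomness can be decreased so that both query marginals become dominated
by prescribed ones, at a total cost of the two total variation distances. -/
theorem exists_weights_le_of_marginals {ρ Q : Type*} [Fintype ρ] [Fintype Q] [DecidableEq Q]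
    {w : ρ → ℝ} (hw : ∀ r, 0 ≤ w r) (q : Bool → ρ → Q) {μ : Bool → Q → ℝ}
    (hμ : ∀ j x, 0 ≤ μ j x) (hsum : ∀ j, ∑ x, μ j x = ∑ r, w r) {η : ℝ}
    (hη : ∀ j, 1 / 2 * ∑ x, |μ j x - ∑ r with q j r = x, w r| ≤ η) :
    ∃ ω : ρ → ℝ, (∀ r, 0 ≤ ω r) ∧ (∀ r, ω r ≤ w r) ∧
      (∀ j x, ∑ r, (if q j r = x then ω r else 0) ≤ μ j x) ∧ ∑ r, (w r - ω r) ≤ 2 * η := by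
  choose v hv0 hv hvμ hvη using fun j => exists_weights_le_of_marginal hw (q j) (hμ j) (hsum j)
  have hmin : ∀ j r, min (v false r) (v true r) ≤ v j r := by
    intro j r; cases j; exacts [min_le_left _ _, min_le_right _ _]
  refine ⟨fun r => min (v false r) (v true r), fun r => le_min (hv0 _ _) (hv0 _ _),
    fun r => (hmin true r).trans (hv _ _), fun j x => ?_, ?_⟩
  · refine (Finset.sum_le_sum fun r _ => ?_).trans (hvμ j x)
    split_ifs
    exacts [hmin j r, le_rfl]
  · calc _ ≤ ∑ r, ((w r - v false r) + (w r - v true r)) := by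
          refine Finset.sum_le_sum fun r _ => ?_
          dsimp only
          rcases min_choice (v false r) (v true r) with h | h <;> rw [h] <;>
            linarith [hv false r, hv true r]
      _ ≤ 2 * η := by
          rw [Finset.sum_add_distrib]
          linarith [hvη false, hvη true, hη false, hη true]

theorem log_two_mul_one_sub_binEnt {θ : ℝ} (h0 : -1 < θ) (h1 : θ < 1) :
    Real.log 2 * (1 - binEnt ((1 + θ) / 2)) = (Real.log (1 + θ) - Real.log (1 - θ)) / 2 * θ +
      (Real.log (1 + θ) + Real.log (1 - θ)) / 2 := by
  have h2 : Real.log 2 ≠ 0 := (Real.log_pos one_lt_two).ne'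
  have e : 1 - (1 + θ) / 2 = (1 - θ) / 2 := by ring
  rw [binEnt, e, Real.logb, Real.logb, Real.log_div (by linarith) two_ne_zero,
    Real.log_div (by linarith) two_ne_zero]
  field_simp
  ring

theorem binEnt_le_one (p : ℝ) : binEnt p ≤ 1 := by
  have h : binEnt p = Real.binEntropy p / Real.log 2 := by
    rw [binEnt, Real.binEntropy_eq_negMulLog_add_negMulLog_one_sub, Real.negMulLog,
      Real.negMulLog, Real.logb, Real.logb]
    ring
  rw [h]
  exact div_le_one_of_le₀ Real.binEntropy_le_log_two (Real.log_nonneg one_le_two)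

theorem sum_mul_bitSign_ge {ρ : Type*} [Fintype ρ] {w ω : ρ → ℝ} (hw1 : ∑ r, w r = 1)
    (hω : ∀ r, ω r ≤ w r) {η : ℝ} (hη : ∑ r, (w r - ω r) ≤ 2 * η) (g : ρ → Bool) (c : Bool)
    {ε : ℝ} (hg : 1 / 2 + ε ≤ ∑ r with g r = c, w r) :
    2 * (ε - η) ≤ ∑ r, ω r * (bitSign (g r) * bitSign c) := by
  have h : ∑ r, w r * (bitSign (g r) * bitSign c) = 2 * ∑ r with g r = c, w r - 1 := by
    rw [← hw1, Finset.sum_filter, Finset.mul_sum, ← Finset.sum_sub_distrib]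
    refine Finset.sum_congr rfl fun r _ => ?_
    cases g r <;> cases c <;> norm_num <;> ring
  have h' : ∑ r, w r * (bitSign (g r) * bitSign c) - ∑ r, ω r * (bitSign (g r) * bitSign c) ≤
      ∑ r, (w r - ω r) := by
    rw [← Finset.sum_sub_distrib]
    refine Finset.sum_le_sum fun r _ => ?_
    have := hω r
    cases g r <;> cases c <;> norm_num <;> linarith
  linarith

end PrivateRetrieval

/-- explicit form of Theorem 12 of the paper: every one-round,
`(1-η)`-secure, 2-server PIR scheme with `n`-bit databases, `t`-bit queries, `ℓ`-bit
answers, recovery probability `1/2 + ε` (where `ε > η`), using `b` bits, satisfies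
`t ≥ d·n - log₂ u - log₂ 6` with `u = Σ_{i=0}^{b} binom(ℓ,i)` and
`d = (1 - H(1/2 + (ε-η)/2^{b+1})) · 2^{b+1}/(3u)`. -/
theorem stmt15 (n t ℓ b : ℕ) (η ε : ℝ) (hεη : η < ε) (P : PIRScheme n t ℓ)
    (hP : P.ProbDist) (hcor : P.Correct ε) (hsec : P.Secure η)
    (hb : P.UsesBits b)
    (u : ℕ) (hu : u = ∑ i ∈ Finset.range (b + 1), ℓ.choose i)
    (d : ℝ)
    (hd : d = (1 - binEnt (1 / 2 + (ε - η) / 2 ^ (b + 1))) * 2 ^ (b + 1) / (3 * u)) :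
    d * n - Real.logb 2 u - Real.logb 2 6 ≤ t := by
  have hu0 : 0 < u := by
    rw [hu]
    exact Finset.sum_pos' (fun _ _ => Nat.zero_le _) ⟨0, by simp, by simp⟩
  have hu' : (0 : ℝ) < u := by exact_mod_cast hu0
  have hlogu : 0 ≤ Real.logb 2 u := Real.logb_nonneg one_lt_two (by exact_mod_cast hu0)
  have hlog6 : 1 ≤ Real.logb 2 6 := by
    rw [Real.le_logb_iff_rpow_le one_lt_two (by norm_num)]
    norm_num
  rcases Nat.eq_zero_or_pos n with rfl | hn
  · have ht : (0 : ℝ) ≤ t := Nat.cast_nonneg t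
    rw [Nat.cast_zero, mul_zero]
    linarith
  obtain ⟨hw, hw1⟩ := hP
  set i₀ : Fin n := ⟨0, hn⟩
  set q : Bool → Fin n → Fin P.R → Fin t → Bool := fun j => bif j then P.q2 else P.q1
  set ans : Bool → (Fin n → Bool) → (Fin t → Bool) → Fin ℓ → Bool :=
    fun j => bif j then P.ans2 else P.ans1
  set μ : Bool → (Fin t → Bool) → ℝ := fun j x => ∑ r with q j i₀ r = x, P.pr r
  have hμ : ∀ j x, 0 ≤ μ j x := fun j x => Finset.sum_nonneg fun r _ => hw r
  have hμ1 : ∀ j, ∑ x, μ j x = ∑ r, P.pr r := fun j => Finset.sum_fiberwise _ _ _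
  have htv : ∀ i j, 1 / 2 * ∑ x, |μ j x - ∑ r with q j i r = x, P.pr r| ≤ η := by
    intro i j
    cases j
    exacts [(hsec i₀ i).1, (hsec i₀ i).2]
  choose ω hω0 hω hωμ hωη using fun i =>
    exists_weights_le_of_marginals hw (fun j => q j i) hμ hμ1 (htv i)
  choose S₀ S₁ hS₀ hS₁ hS using hb
  have hη0 : 0 ≤ η := le_trans (by positivity) (htv i₀ true)
  have hε : ε ≤ 1 / 2 := by
    have h := (hcor (fun _ => false) i₀).trans
      (Finset.sum_le_univ_sum_of_nonneg hw)
    rw [hw1] at h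
    linarith
  set θ : ℝ := (ε - η) / 2 ^ b with hθ
  have h2b : (1 : ℝ) ≤ 2 ^ b := one_le_pow₀ one_le_two
  have hθ0 : 0 ≤ θ := div_nonneg (by linarith) (by positivity)
  have hθ1 : θ < 1 := by
    rw [hθ, div_lt_one (by positivity)]
    linarith
  have hθb : θ * 2 ^ b = ε - η := div_mul_cancel₀ _ (by positivity)
  have key := exp_mul_le_of_biased_decoding (q := q) (S := fun j => bif j then S₁ else S₀)
    hω0 (fun i => (Finset.sum_le_sum fun r _ => hω i r).trans_eq hw1) hμ
    (fun j => (hμ1 j).trans hw1) (fun j i x => hωμ i j x)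
    (fun j => by cases j; exacts [hS₀, hS₁]) hu (fun x j => ans j x) P.out hS
    (fun x i => sum_mul_bitSign_ge hw1 (hω i) (hωη i) _ _ (hcor x i)) hθ0 hθ1
  have hp : 1 / 2 + (ε - η) / 2 ^ (b + 1) = (1 + θ) / 2 := by
    rw [hθ, pow_succ]
    ring
  have hX := log_two_mul_one_sub_binEnt (by linarith : -1 < θ) hθ1
  rw [hp] at hd
  set E := 1 - binEnt ((1 + θ) / 2)
  have hE0 : 0 ≤ E := by linarith [binEnt_le_one ((1 + θ) / 2)]
  have hl2 : 0 < Real.log 2 := Real.log_pos one_lt_two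
  have hlam : 0 ≤ (Real.log (1 + θ) - Real.log (1 - θ)) / 2 := by
    have := Real.log_le_log (by linarith : 0 < 1 - θ) (by linarith : 1 - θ ≤ 1 + θ)
    linarith
  have hexp : d * Real.log 2 ≤ ((Real.log (1 + θ) - Real.log (1 - θ)) / 2 * (2 * (ε - η)) +
      (Real.log (1 + θ) + Real.log (1 - θ)) / 2 * 2 ^ b) / u := by
    have hnn : 0 ≤ Real.log 2 * E * 2 ^ b := by positivity
    have h1 := mul_nonneg hlam (sub_nonneg.2 hεη.le)
    have h2 : Real.log 2 * E * 2 ^ b = (Real.log (1 + θ) - Real.log (1 - θ)) / 2 * (ε - η) +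
        (Real.log (1 + θ) + Real.log (1 - θ)) / 2 * 2 ^ b := by
      rw [hX, ← hθb]
      ring
    have h3 : d * Real.log 2 = (2 / 3 * (Real.log 2 * E * 2 ^ b)) / u := by
      rw [hd, pow_succ]
      field_simp
    rw [h3]
    refine div_le_div_of_nonneg_right ?_ hu'.le
    linarith
  have hcard : (Fintype.card (Fin t → Bool) : ℝ) = 2 ^ t := by simp
  have hfin : n * (d * Real.log 2) ≤ Real.log (2 * 2 ^ t * u) := by
    rw [Real.le_log_iff_exp_le (by positivity), ← hcard]
    refine le_trans (Real.exp_le_exp.2 ?_) key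
    gcongr
  rw [Real.log_mul (by positivity) hu'.ne', Real.log_mul two_ne_zero (by positivity),
    Real.log_pow] at hfin
  have hlu : Real.log u = Real.logb 2 u * Real.log 2 := (div_mul_cancel₀ _ hl2.ne').symm
  rw [hlu] at hfin
  have hfin' : d * n ≤ 1 + t + Real.logb 2 u := by
    refine le_of_mul_le_mul_right ?_ hl2
    linarith
  linarith
end

section
/- For every fixed b ≥ 1 there exists a constant K > 0 such that for all n, t, ℓ, every one-round 2-server private information retrieval scheme for n-bit databases with query size t, answer size ℓ, perfect recovery (recovery probability 1, i.e., ε = 1/2) and perfect privacy (η = 0), that uses b bits, has total communication 2(t + ℓ) ≥ K · n^{1/(b+1)}. -/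
open Matrix in
theorem Matrix.IsHermitian.exists_orthogonal_diagonalization {V : Type*} [Fintype V]
    [DecidableEq V] {A : Matrix V V ℝ} (hA : A.IsHermitian) :
    ∃ (U : Matrix V V ℝ) (d : V → ℝ), U * Uᵀ = 1 ∧ Uᵀ * U = 1 ∧
      ∀ j : ℕ, A ^ j = U * diagonal (fun a => d a ^ j) * Uᵀ := by
  have h := hA.spectral_theorem
  have h1 : (hA.eigenvectorUnitary : Matrix V V ℝ) * (hA.eigenvectorUnitary : Matrix V V ℝ)ᵀ = 1 := by
    have := Unitary.mul_star_self_of_mem hA.eigenvectorUnitary.2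
    simpa [star_eq_conjTranspose, conjTranspose_eq_transpose_of_trivial] using this
  have h2 : (hA.eigenvectorUnitary : Matrix V V ℝ)ᵀ * (hA.eigenvectorUnitary : Matrix V V ℝ) = 1 := by
    have := Unitary.star_mul_self_of_mem hA.eigenvectorUnitary.2
    simpa [star_eq_conjTranspose, conjTranspose_eq_transpose_of_trivial] using this
  have h3 : A = (hA.eigenvectorUnitary : Matrix V V ℝ) * diagonal hA.eigenvalues *
      (hA.eigenvectorUnitary : Matrix V V ℝ)ᵀ := by
    conv_lhs => rw [h]
    simp [Unitary.conjStarAlgAut_apply, star_eq_conjTranspose,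
      conjTranspose_eq_transpose_of_trivial]
  refine ⟨_, hA.eigenvalues, h1, h2, fun j => ?_⟩
  generalize (hA.eigenvectorUnitary : Matrix V V ℝ) = U at *
  generalize hA.eigenvalues = d at *
  induction j with
  | zero => simp [h1]
  | succ j ih =>
    rw [pow_succ, ih]
    conv_lhs => rw [h3]
    calc U * diagonal (fun a => d a ^ j) * Uᵀ * (U * diagonal d * Uᵀ)
        = U * diagonal (fun a => d a ^ j) * (Uᵀ * U) * diagonal d * Uᵀ := by
          simp only [Matrix.mul_assoc]
      _ = _ := by
          rw [h2, Matrix.mul_one, Matrix.mul_assoc U, diagonal_mul_diagonal]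
          simp only [pow_succ]

theorem sum_pow_mul_pow_sub_le (m : ℕ) (hm : Even m) (x y : ℝ) :
    ∑ j ∈ Finset.range (m + 1), x ^ j * y ^ (m - j) ≤ (m + 1) / 2 * (x ^ m + y ^ m) := by
  have key : ∀ j ∈ Finset.range (m + 1),
      x ^ j * y ^ (m - j) + x ^ (m - j) * y ^ j ≤ x ^ m + y ^ m := by
    intro j hj
    have hj' : j ≤ m := Nat.lt_succ_iff.mp (Finset.mem_range.mp hj)
    obtain ⟨l, rfl⟩ := Nat.exists_eq_add_of_le hj'
    rw [Nat.add_sub_cancel_left, ← hm.pow_abs x, ← hm.pow_abs y]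
    have h1 : x ^ j * y ^ l ≤ |x| ^ j * |y| ^ l := by
      simpa [abs_mul, abs_pow] using le_abs_self (x ^ j * y ^ l)
    have h2 : x ^ l * y ^ j ≤ |x| ^ l * |y| ^ j := by
      simpa [abs_mul, abs_pow] using le_abs_self (x ^ l * y ^ j)
    have h3 : 0 ≤ (|x| ^ j - |y| ^ j) * (|x| ^ l - |y| ^ l) := by
      rcases le_total |x| |y| with h | h
      · exact mul_nonneg_of_nonpos_of_nonpos
          (sub_nonpos.2 (pow_le_pow_left₀ (abs_nonneg _) h _))
          (sub_nonpos.2 (pow_le_pow_left₀ (abs_nonneg _) h _))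
      · exact mul_nonneg
          (sub_nonneg.2 (pow_le_pow_left₀ (abs_nonneg _) h _))
          (sub_nonneg.2 (pow_le_pow_left₀ (abs_nonneg _) h _))
    rw [pow_add, pow_add]
    nlinarith
  have hsum := Finset.sum_le_sum key
  rw [Finset.sum_add_distrib] at hsum
  have hrefl : ∑ j ∈ Finset.range (m + 1), x ^ (m - j) * y ^ j =
      ∑ j ∈ Finset.range (m + 1), x ^ j * y ^ (m - j) := by
    rw [← Finset.sum_range_reflect]
    refine Finset.sum_congr rfl fun j hj => ?_
    have hj' : j ≤ m := Nat.lt_succ_iff.mp (Finset.mem_range.mp hj)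
    rw [show m + 1 - 1 - j = m - j by omega, show m - (m - j) = j by omega]
  rw [hrefl] at hsum
  simp only [Finset.sum_const, Finset.card_range, nsmul_eq_mul] at hsum
  push_cast at hsum
  linarith

open Matrix in
theorem Matrix.sum_trace_mul_pow_mul_pow_le {V : Type*} [Fintype V] [DecidableEq V]
    {M A B : Matrix V V ℝ} (hM : M.IsHermitian) (hA : A.IsHermitian) (hB : B.IsHermitian)
    (m : ℕ) (hm : Even m) :
    ∑ j ∈ Finset.range (m + 1), trace (M * A ^ j * M * B ^ (m - j)) ≤
      (m + 1) / 2 * (trace (M * A ^ m * M) + trace (M * B ^ m * M)) := by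
  obtain ⟨U, d, hU, hU', hAd⟩ := hA.exists_orthogonal_diagonalization
  obtain ⟨W, e, hW, hW', hBe⟩ := hB.exists_orthogonal_diagonalization
  have hMt : Mᵀ = M := by
    simpa [conjTranspose_eq_transpose_of_trivial] using hM.eq
  set N := Uᵀ * M * W with hN
  have hNt : Nᵀ = Wᵀ * M * U := by
    simp [hN, transpose_mul, hMt, Matrix.mul_assoc]
  have key : ∀ j l : ℕ, trace (M * A ^ j * M * B ^ l) =
      ∑ a, ∑ c, N a c ^ 2 * (d a ^ j * e c ^ l) := by
    intro j l
    have : trace (M * A ^ j * M * B ^ l) =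
        trace (N * diagonal (fun c => e c ^ l) * (Nᵀ * diagonal (fun a => d a ^ j))) := by
      rw [hAd, hBe, hNt, hN]
      calc _ = trace ((M * U * diagonal (fun a => d a ^ j)) *
            (Uᵀ * M * W * diagonal (fun c => e c ^ l) * Wᵀ)) := by simp only [Matrix.mul_assoc]
        _ = trace ((Uᵀ * M * W * diagonal (fun c => e c ^ l) * Wᵀ) *
            (M * U * diagonal (fun a => d a ^ j))) := trace_mul_comm _ _
        _ = _ := by simp only [Matrix.mul_assoc]
    rw [this]
    simp only [trace, diag_apply, mul_apply (M := N * _), mul_diagonal, transpose_apply]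
    refine Finset.sum_congr rfl fun a _ => Finset.sum_congr rfl fun c _ => ?_
    ring
  have hA0 : trace (M * A ^ m * M) = trace (M * A ^ m * M * B ^ 0) := by simp
  have hB0 : trace (M * B ^ m * M) = trace (M * A ^ 0 * M * B ^ m) := by
    rw [pow_zero, Matrix.mul_one, trace_mul_cycle]
  rw [hA0, hB0, key m 0, key 0 m]
  simp only [key, pow_zero, mul_one, one_mul]
  rw [Finset.sum_comm, ← Finset.sum_add_distrib, Finset.mul_sum]
  refine Finset.sum_le_sum fun a _ => ?_
  rw [Finset.sum_comm, ← Finset.sum_add_distrib, Finset.mul_sum]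
  refine Finset.sum_le_sum fun c _ => ?_
  rw [← Finset.mul_sum]
  have := mul_le_mul_of_nonneg_left (sum_pow_mul_pow_sub_le m hm (d a) (e c)) (sq_nonneg (N a c))
  linarith

theorem pow_sub_pow_eq_sum {R : Type*} [Ring R] (A B : R) (m : ℕ) :
    A ^ (m + 1) - B ^ (m + 1) =
      ∑ j ∈ Finset.range (m + 1), A ^ j * (A - B) * B ^ (m - j) := by
  induction m with
  | zero => simp
  | succ m ih =>
    rw [Finset.sum_range_succ]
    have : ∑ j ∈ Finset.range (m + 1), A ^ j * (A - B) * B ^ (m + 1 - j) =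
        (∑ j ∈ Finset.range (m + 1), A ^ j * (A - B) * B ^ (m - j)) * B := by
      rw [Finset.sum_mul]
      refine Finset.sum_congr rfl fun j hj => ?_
      have hj' : j ≤ m := Nat.lt_succ_iff.mp (Finset.mem_range.mp hj)
      rw [show m + 1 - j = (m - j) + 1 by omega, pow_succ]
      simp only [mul_assoc]
    rw [this, ← ih]
    simp only [Nat.sub_self, pow_zero, mul_one, mul_sub, sub_mul, ← pow_succ]
    abel

/-- The sign `(-1) ^ c` of a bit `c`. -/
def Bool.signReal (c : Bool) : ℝ := if c then -1 else 1

theorem Bool.signReal_mul_self (c : Bool) : c.signReal * c.signReal = 1 := by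
  cases c <;> simp [Bool.signReal]

theorem Bool.signReal_not (c : Bool) : (!c).signReal = - c.signReal := by
  cases c <;> simp [Bool.signReal]

theorem Bool.abs_signReal (c : Bool) : |c.signReal| = 1 := by
  cases c <;> simp [Bool.signReal]

/-- The signed sum `∑ i, (-1) ^ x i • M i`. -/
def signedSum {n : ℕ} {V : Type*} (M : Fin n → Matrix V V ℝ) (x : Fin n → Bool) :
    Matrix V V ℝ :=
  ∑ i, (x i).signReal • M i

theorem isHermitian_signedSum {n : ℕ} {V : Type*} {M : Fin n → Matrix V V ℝ}
    (hM : ∀ i, (M i).IsHermitian) (x : Fin n → Bool) : (signedSum M x).IsHermitian := by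
  unfold signedSum Matrix.IsHermitian
  rw [Matrix.conjTranspose_sum]
  refine Finset.sum_congr rfl fun i _ => ?_
  rw [Matrix.conjTranspose_smul, (hM i).eq]
  simp

/-- The bit string `x` with its `i`-th bit flipped. -/
def flipBit {n : ℕ} (i : Fin n) (x : Fin n → Bool) : Fin n → Bool :=
  Function.update x i (!x i)

theorem flipBit_involutive {n : ℕ} (i : Fin n) : Function.Involutive (flipBit i) := by
  intro x
  simp [flipBit]

theorem sum_flipBit {n : ℕ} (i : Fin n) (G : (Fin n → Bool) → ℝ) :
    ∑ x, G (flipBit i x) = ∑ x, G x :=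
  Equiv.sum_comp (flipBit_involutive i).toPerm G

theorem signedSum_sub_flipBit {n : ℕ} {V : Type*} (M : Fin n → Matrix V V ℝ)
    (x : Fin n → Bool) (i : Fin n) :
    signedSum M x - signedSum M (flipBit i x) = (2 * (x i).signReal) • M i := by
  unfold signedSum
  rw [← Finset.sum_sub_distrib, Finset.sum_eq_single i]
  · simp only [flipBit, Function.update_self, Bool.signReal_not]
    rw [← sub_smul]
    congr 1
    ring
  · intro j _ hj
    simp [flipBit, Function.update_of_ne hj]
  · simp

open Matrix in
theorem sum_sign_trace_le {n : ℕ} {V : Type*} [Fintype V] [DecidableEq V]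
    {M : Fin n → Matrix V V ℝ} (hM : ∀ i, (M i).IsHermitian) (m : ℕ) (hm : Even m) (i : Fin n) :
    ∑ x, (x i).signReal * trace (M i * signedSum M x ^ (m + 1)) ≤
      (m + 1) * ∑ x, trace (M i * signedSum M x ^ m * M i) := by
  have hpt : ∀ x : Fin n → Bool, (x i).signReal * trace (M i * signedSum M x ^ (m + 1)) -
      (x i).signReal * trace (M i * signedSum M (flipBit i x) ^ (m + 1)) ≤
      (m + 1) * (trace (M i * signedSum M x ^ m * M i) +
        trace (M i * signedSum M (flipBit i x) ^ m * M i)) := by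
    intro x
    have h := Matrix.sum_trace_mul_pow_mul_pow_le (hM i) (isHermitian_signedSum hM x)
      (isHermitian_signedSum hM (flipBit i x)) m hm
    have h2 : (x i).signReal * trace (M i * signedSum M x ^ (m + 1)) -
        (x i).signReal * trace (M i * signedSum M (flipBit i x) ^ (m + 1)) =
        2 * ∑ j ∈ Finset.range (m + 1), trace (M i * signedSum M x ^ j * M i *
          signedSum M (flipBit i x) ^ (m - j)) := by
      rw [← mul_sub, ← trace_sub, ← Matrix.mul_sub, pow_sub_pow_eq_sum, Finset.mul_sum, trace_sum,
        Finset.mul_sum, Finset.mul_sum]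
      refine Finset.sum_congr rfl fun j _ => ?_
      rw [signedSum_sub_flipBit]
      simp only [Matrix.mul_smul, Matrix.smul_mul, trace_smul, smul_eq_mul, Matrix.mul_assoc]
      rw [← mul_assoc, mul_left_comm, Bool.signReal_mul_self, mul_one]
    rw [h2]
    linarith
  have hs := Finset.sum_le_sum fun x (_ : x ∈ Finset.univ) => hpt x
  rw [Finset.sum_sub_distrib, ← Finset.mul_sum, Finset.sum_add_distrib,
    sum_flipBit i fun x => trace (M i * signedSum M x ^ m * M i)] at hs
  have hf : ∑ x, (x i).signReal * trace (M i * signedSum M (flipBit i x) ^ (m + 1)) =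
      - ∑ x, (x i).signReal * trace (M i * signedSum M x ^ (m + 1)) := by
    rw [← sum_flipBit i, ← Finset.sum_neg_distrib]
    refine Finset.sum_congr rfl fun x _ => ?_
    rw [flipBit_involutive i x]
    simp [flipBit, Bool.signReal_not]
  rw [hf] at hs
  linarith

open Matrix in
theorem sum_trace_mul_pow_mul_le {n : ℕ} {V : Type*} [Fintype V] [DecidableEq V]
    {M : Fin n → Matrix V V ℝ} (hM : ∀ i, (M i).IsHermitian) {w : ℝ}
    (hw : ∀ y : V → ℝ, ∑ i, (M i *ᵥ y) ⬝ᵥ (M i *ᵥ y) ≤ w * (y ⬝ᵥ y))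
    {A : Matrix V V ℝ} (hA : A.IsHermitian) (p : ℕ) :
    ∑ i, trace (M i * A ^ (2 * p) * M i) ≤ w * trace (A ^ (2 * p)) := by
  have hAt : (A ^ p)ᵀ = A ^ p := by
    simpa [conjTranspose_eq_transpose_of_trivial] using (hA.pow p).eq
  have hMt : ∀ i, (M i)ᵀ = M i := fun i => by
    simpa [conjTranspose_eq_transpose_of_trivial] using (hM i).eq
  have h1 : ∀ i, trace (M i * A ^ (2 * p) * M i) =
      ∑ c, (M i *ᵥ (fun a => (A ^ p) a c)) ⬝ᵥ (M i *ᵥ (fun a => (A ^ p) a c)) := by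
    intro i
    have : M i * A ^ (2 * p) * M i = (M i * A ^ p) * (M i * A ^ p)ᵀ := by
      rw [transpose_mul, hAt, hMt, two_mul, pow_add]
      simp only [Matrix.mul_assoc]
    rw [this, trace_mul_comm]
    rfl
  have h2 : trace (A ^ (2 * p)) = ∑ c, (fun a => (A ^ p) a c) ⬝ᵥ (fun a => (A ^ p) a c) := by
    have : A ^ (2 * p) = (A ^ p)ᵀ * A ^ p := by rw [hAt, two_mul, pow_add]
    rw [this]
    rfl
  simp only [h1]
  rw [h2, Finset.sum_comm, Finset.mul_sum]
  exact Finset.sum_le_sum fun c _ => hw _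

open Matrix in
/-- A matrix Khintchine inequality for signed sums of symmetric matrices. -/
theorem sum_trace_signedSum_pow_le {n : ℕ} {V : Type*} [Fintype V] [DecidableEq V]
    {M : Fin n → Matrix V V ℝ} (hM : ∀ i, (M i).IsHermitian) {w : ℝ} (hw0 : 0 ≤ w)
    (hw : ∀ y : V → ℝ, ∑ i, (M i *ᵥ y) ⬝ᵥ (M i *ᵥ y) ≤ w * (y ⬝ᵥ y)) (K k : ℕ) (hk : k ≤ K) :
    ∑ x, trace (signedSum M x ^ (2 * k)) ≤ (2 * K * w) ^ k * (2 ^ n * Fintype.card V) := by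
  induction k with
  | zero => simp
  | succ k ih =>
    have ih := ih (by omega)
    have h1 : ∀ x, trace (signedSum M x ^ (2 * (k + 1))) =
        ∑ i, (x i).signReal * trace (M i * signedSum M x ^ (2 * k + 1)) := by
      intro x
      rw [show 2 * (k + 1) = (2 * k + 1) + 1 by ring, pow_succ']
      conv_lhs => enter [1, 1]; rw [signedSum]
      rw [Finset.sum_mul, trace_sum]
      simp
    have hnn : 0 ≤ w * ∑ x, trace (signedSum M x ^ (2 * k)) := by
      refine mul_nonneg hw0 (Finset.sum_nonneg fun x _ => ?_)
      have hAt : (signedSum M x ^ k)ᵀ = signedSum M x ^ k := by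
        simpa [conjTranspose_eq_transpose_of_trivial] using
          ((isHermitian_signedSum hM x).pow k).eq
      have : signedSum M x ^ (2 * k) = (signedSum M x ^ k)ᵀ * signedSum M x ^ k := by
        rw [hAt, two_mul, pow_add]
      rw [this]
      exact Finset.sum_nonneg fun c _ => Finset.sum_nonneg fun a _ => mul_self_nonneg _
    calc ∑ x, trace (signedSum M x ^ (2 * (k + 1)))
        = ∑ i, ∑ x : Fin n → Bool,
            (x i).signReal * trace (M i * signedSum M x ^ (2 * k + 1)) := by
          simp only [h1]
          exact Finset.sum_comm
      _ ≤ ∑ i, ((2 * k : ℕ) + 1) * ∑ x, trace (M i * signedSum M x ^ (2 * k) * M i) :=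
          Finset.sum_le_sum fun i _ => sum_sign_trace_le hM (2 * k) (even_two_mul k) i
      _ = (2 * k + 1) * ∑ x, ∑ i, trace (M i * signedSum M x ^ (2 * k) * M i) := by
          rw [← Finset.mul_sum, Finset.sum_comm]
          push_cast
          rfl
      _ ≤ (2 * k + 1) * ∑ x, w * trace (signedSum M x ^ (2 * k)) := by
          gcongr with x
          exact sum_trace_mul_pow_mul_le hM hw (isHermitian_signedSum hM x) k
      _ = (2 * k + 1) * (w * ∑ x, trace (signedSum M x ^ (2 * k))) := by
          rw [Finset.mul_sum (a := w)]
      _ ≤ (2 * K) * (w * ∑ x, trace (signedSum M x ^ (2 * k))) := by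
          have : (k : ℝ) + 1 ≤ K := by exact_mod_cast hk
          gcongr
          linarith
      _ ≤ (2 * K) * (w * ((2 * K * w) ^ k * (2 ^ n * Fintype.card V))) := by gcongr
      _ = _ := by ring

open Matrix in
theorem Matrix.IsHermitian.pow_le_trace_pow {V : Type*} [Fintype V] [DecidableEq V]
    {A : Matrix V V ℝ} (hA : A.IsHermitian) {α : ℝ} (hα : 0 ≤ α) {φ : V → ℝ}
    (hφ : 0 < φ ⬝ᵥ φ) (h : α * (φ ⬝ᵥ φ) ≤ φ ⬝ᵥ (A *ᵥ φ)) (k : ℕ) :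
    α ^ (2 * k) ≤ trace (A ^ (2 * k)) := by
  obtain ⟨U, d, hU, hU', hAd⟩ := hA.exists_orthogonal_diagonalization
  set ψ := Uᵀ *ᵥ φ with hψ
  have h1 : φ ⬝ᵥ φ = ∑ a, ψ a * ψ a := by
    change _ = ψ ⬝ᵥ ψ
    rw [hψ, dotProduct_mulVec, vecMul_transpose, mulVec_mulVec, hU, one_mulVec]
  have h2 : φ ⬝ᵥ (A *ᵥ φ) = ∑ a, d a * (ψ a * ψ a) := by
    have hA1 := hAd 1
    simp only [pow_one] at hA1
    rw [hA1, ← mulVec_mulVec, ← mulVec_mulVec, ← hψ, dotProduct_mulVec, ← mulVec_transpose, ← hψ]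
    simp only [dotProduct, mulVec_diagonal]
    exact Finset.sum_congr rfl fun a _ => by ring
  have h3 : trace (A ^ (2 * k)) = ∑ a, d a ^ (2 * k) := by
    rw [hAd, trace_mul_comm, ← Matrix.mul_assoc, hU', Matrix.one_mul, trace_diagonal]
  obtain ⟨a, ha⟩ : ∃ a, α ≤ d a := by
    by_contra! hc
    rw [h1] at hφ
    obtain ⟨a, -, ha⟩ : ∃ a ∈ Finset.univ, 0 < ψ a * ψ a := by
      by_contra! hn
      exact absurd (Finset.sum_nonpos hn) (not_le.2 hφ)
    rw [h1, h2, Finset.mul_sum] at h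
    refine absurd h (not_le.2 (Finset.sum_lt_sum (fun c _ => ?_) ⟨a, Finset.mem_univ _, ?_⟩))
    · exact mul_le_mul_of_nonneg_right (hc c).le (mul_self_nonneg _)
    · exact mul_lt_mul_of_pos_right (hc a) ha
  rw [h3]
  calc α ^ (2 * k) ≤ d a ^ (2 * k) := by gcongr
    _ ≤ _ := Finset.single_le_sum (f := fun a => d a ^ (2 * k))
      (fun c _ => (even_two_mul k).pow_nonneg _) (Finset.mem_univ a)

open Matrix in
theorem sq_le_of_quadratic_form_signedSum {n : ℕ} {V : Type*} [Fintype V] [DecidableEq V]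
    {M : Fin n → Matrix V V ℝ} (hM : ∀ i, (M i).IsHermitian) {w : ℝ} (hw0 : 0 ≤ w)
    (hw : ∀ y : V → ℝ, ∑ i, (M i *ᵥ y) ⬝ᵥ (M i *ᵥ y) ≤ w * (y ⬝ᵥ y))
    {α : ℝ} (hα : 0 ≤ α) (φ : (Fin n → Bool) → V → ℝ) (hφ : ∀ x, 0 < φ x ⬝ᵥ φ x)
    (h : ∀ x, α * (φ x ⬝ᵥ φ x) ≤ φ x ⬝ᵥ (signedSum M x *ᵥ φ x))
    {k : ℕ} (hk : k ≠ 0) (hV : Fintype.card V ≤ 2 ^ k) :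
    α ^ 2 ≤ 4 * k * w := by
  have h1 := Finset.sum_le_sum fun x (_ : x ∈ Finset.univ) =>
    (isHermitian_signedSum hM x).pow_le_trace_pow hα (hφ x) (h x) k
  have h2 := h1.trans (sum_trace_signedSum_pow_le hM hw0 hw k k le_rfl)
  have hV' : (Fintype.card V : ℝ) ≤ 2 ^ k := by exact_mod_cast hV
  simp only [Finset.sum_const, Finset.card_univ, Fintype.card_fun, Fintype.card_bool,
    Fintype.card_fin, nsmul_eq_mul] at h2
  push_cast at h2
  have h3 : (α ^ 2) ^ k ≤ (4 * k * w) ^ k := by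
    have h4 : (2 * k * w) ^ k * (2 ^ n * (Fintype.card V : ℝ)) ≤
        (2 * k * w) ^ k * (2 ^ n * 2 ^ k) := by gcongr
    have h5 : (2 : ℝ) ^ n * α ^ (2 * k) ≤ 2 ^ n * ((2 * k * w) ^ k * 2 ^ k) := by linarith
    have h6 := le_of_mul_le_mul_left h5 (by positivity)
    rw [← mul_pow, pow_mul] at h6
    calc _ ≤ _ := h6
      _ = _ := by ring
  exact le_of_pow_le_pow_left₀ hk (by positivity) h3

/-- The matrix on `W × U` of a weighted graph on `W` with edge set `E`: the edge `e` has weight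
`p e`, source `s e`, target `s (τ e)` and label matrix `F e`; the rows and columns of
`w : W` are scaled by `1 / √(ν w)`. -/
noncomputable def edgeMatrix {E W U : Type*} [Fintype E] [DecidableEq W]
    (p : E → ℝ) (s : E → W) (τ : E → E) (F : E → U → U → ℝ) (ν : W → ℝ) :
    Matrix (W × U) (W × U) ℝ := fun v v' =>
  (∑ e, if s e = v.1 ∧ s (τ e) = v'.1 then p e * F e v.2 v'.2 else 0) /
    (√(ν v.1) * √(ν v'.1))

theorem isHermitian_edgeMatrix {E W U : Type*} [Fintype E] [DecidableEq W]
    {p : E → ℝ} {s : E → W} {τ : E → E} {F : E → U → U → ℝ} {ν : W → ℝ}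
    (hτ : Function.Involutive τ) (hp : ∀ e, p (τ e) = p e)
    (hF : ∀ e u u', F (τ e) u u' = F e u' u) : (edgeMatrix p s τ F ν).IsHermitian := by
  ext v v'
  simp only [Matrix.conjTranspose_apply, edgeMatrix, star_trivial]
  rw [mul_comm (√(ν v'.1)), ← Equiv.sum_comp hτ.toPerm]
  congr 1
  refine Finset.sum_congr rfl fun e _ => ?_
  simp only [Function.Involutive.coe_toPerm, hτ e, hp, hF, and_comm]

open Matrix in
theorem edgeMatrix_mulVec_apply {E W U : Type*} [Fintype E] [Fintype W] [DecidableEq W]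
    [Fintype U] (p : E → ℝ) (s : E → W) (τ : E → E) (F : E → U → U → ℝ) (ν : W → ℝ)
    (y : W × U → ℝ) (w : W) (u : U) :
    (edgeMatrix p s τ F ν *ᵥ y) (w, u) =
      (∑ e, ∑ u', if s e = w then p e * (F e u u' * (y (s (τ e), u') / √(ν (s (τ e))))) else 0) /
        √(ν w) := by
  simp only [mulVec, dotProduct, edgeMatrix, Fintype.sum_prod_type]
  have h1 : ∀ w' u', (∑ e, if s e = w ∧ s (τ e) = w' then p e * F e u u' else 0) /
      (√(ν w) * √(ν w')) * y (w', u') = ∑ e, if s (τ e) = w' then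
        (if s e = w then p e * (F e u u' * (y (s (τ e), u') / √(ν (s (τ e))))) else 0) / √(ν w)
        else 0 := by
    intro w' u'
    rw [div_mul_eq_mul_div, Finset.sum_mul, Finset.sum_div]
    refine Finset.sum_congr rfl fun e _ => ?_
    by_cases h : s (τ e) = w'
    · by_cases h' : s e = w
      · simp only [h, h', and_self, if_true]
        simp only [div_eq_mul_inv, mul_inv]
        ring
      · simp [h']
    · simp [h]
  simp only [h1]
  rw [Finset.sum_comm, Finset.sum_congr rfl fun u' _ => Finset.sum_comm]
  simp only [Finset.sum_ite_eq, Finset.mem_univ, if_true]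
  rw [Finset.sum_comm]
  simp only [Finset.sum_div]

open Matrix in
theorem edgeMatrix_mulVec_dotProduct_le {E W U : Type*} [Fintype E] [Fintype W] [DecidableEq W]
    [Fintype U] {p : E → ℝ} {s : E → W} {τ : E → E} {F : E → U → U → ℝ} {ν : W → ℝ} {L : ℝ}
    (hτ : Function.Involutive τ) (hp : ∀ e, p (τ e) = p e) (hp0 : ∀ e, 0 ≤ p e)
    (hF : ∀ e u u', F e u u' ^ 2 ≤ 1) (hν : ∀ w, 0 ≤ ν w) (hL0 : 0 ≤ L)
    (hL : ∀ w, (∑ e, if s e = w then p e else 0) ≤ L * ν w) (y : W × U → ℝ) :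
    (edgeMatrix p s τ F ν *ᵥ y) ⬝ᵥ (edgeMatrix p s τ F ν *ᵥ y) ≤
      Fintype.card U ^ 2 * L *
        ∑ w, ∑ u, (∑ e, if s e = w then p e else 0) / ν w * y (w, u) ^ 2 := by
  set z : W → U → ℝ := fun w u => y (w, u) / √(ν w) with hz
  have hpt : ∀ w u, (edgeMatrix p s τ F ν *ᵥ y) (w, u) ^ 2 ≤
      Fintype.card U * L * ∑ e, ∑ u', if s e = w then p e * z (s (τ e)) u' ^ 2 else 0 := by
    intro w u
    rw [edgeMatrix_mulVec_apply, div_pow, Real.sq_sqrt (hν w)]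
    have hcs : (∑ e, ∑ u', if s e = w then p e * (F e u u' * z (s (τ e)) u') else 0) ^ 2 ≤
        (∑ e, ∑ _u' : U, if s e = w then p e else 0) *
          ∑ e, ∑ u', if s e = w then p e * z (s (τ e)) u' ^ 2 else 0 := by
      simp only [← Fintype.sum_prod_type']
      refine Finset.sum_sq_le_sum_mul_sum_of_sq_le_mul _ (fun a _ => ?_) (fun a _ => ?_)
        (fun a _ => ?_)
      · split_ifs
        exacts [hp0 _, le_rfl]
      · split_ifs
        exacts [mul_nonneg (hp0 _) (sq_nonneg _), le_rfl]
      · split_ifs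
        · have := mul_le_mul_of_nonneg_left (hF a.1 u a.2)
            (mul_nonneg (sq_nonneg (p a.1)) (sq_nonneg (z (s (τ a.1)) a.2)))
          nlinarith
        · simp
    have hnn : 0 ≤ ∑ e, ∑ u', if s e = w then p e * z (s (τ e)) u' ^ 2 else 0 := by
      refine Finset.sum_nonneg fun e _ => Finset.sum_nonneg fun u' _ => ?_
      split_ifs
      exacts [mul_nonneg (hp0 _) (sq_nonneg _), le_rfl]
    have hc : (∑ e, ∑ _u' : U, if s e = w then p e else 0) ≤ Fintype.card U * L * ν w := by
      simp only [Finset.sum_const, Finset.card_univ, nsmul_eq_mul, ← Finset.mul_sum]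
      rw [mul_assoc]
      exact mul_le_mul_of_nonneg_left (hL w) (Nat.cast_nonneg _)
    refine div_le_of_le_mul₀ (hν w) (by positivity) (hcs.trans ?_)
    calc _ ≤ _ := mul_le_mul_of_nonneg_right hc hnn
      _ = _ := by ring
  have hsum : ∑ w, ∑ e, ∑ u', (if s e = w then p e * z (s (τ e)) u' ^ 2 else 0) =
      ∑ w, ∑ u, (∑ e, if s e = w then p e else 0) / ν w * y (w, u) ^ 2 := by
    calc _ = ∑ e, ∑ u', p e * z (s (τ e)) u' ^ 2 := by
          rw [Finset.sum_comm]
          refine Finset.sum_congr rfl fun e _ => ?_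
          rw [Finset.sum_comm]
          simp
      _ = ∑ e, ∑ u', p e * z (s e) u' ^ 2 := by
          rw [← Equiv.sum_comp hτ.toPerm]
          simp only [Function.Involutive.coe_toPerm, hτ _, hp]
      _ = ∑ e, ∑ w, ∑ u, (if s e = w then p e else 0) * z w u ^ 2 := by
          refine Finset.sum_congr rfl fun e _ => ?_
          rw [Finset.sum_comm]
          simp
      _ = _ := by
          rw [Finset.sum_comm]
          refine Finset.sum_congr rfl fun w _ => ?_
          rw [Finset.sum_comm]
          refine Finset.sum_congr rfl fun u _ => ?_
          rw [← Finset.sum_mul, hz]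
          simp only [div_pow, Real.sq_sqrt (hν w)]
          ring
  calc (edgeMatrix p s τ F ν *ᵥ y) ⬝ᵥ (edgeMatrix p s τ F ν *ᵥ y)
      = ∑ w, ∑ u, (edgeMatrix p s τ F ν *ᵥ y) (w, u) ^ 2 := by
        simp only [dotProduct, Fintype.sum_prod_type, sq]
    _ ≤ ∑ w, ∑ _u : U, Fintype.card U * L *
          ∑ e, ∑ u', if s e = w then p e * z (s (τ e)) u' ^ 2 else 0 :=
        Finset.sum_le_sum fun w _ => Finset.sum_le_sum fun u _ => hpt w u
    _ = Fintype.card U ^ 2 * L *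
          ∑ w, ∑ e, ∑ u', (if s e = w then p e * z (s (τ e)) u' ^ 2 else 0) := by
        simp only [Finset.sum_const, Finset.card_univ, nsmul_eq_mul, Finset.mul_sum]
        simp only [← mul_assoc, sq]
    _ = _ := by rw [hsum]

open Matrix in
theorem edgeMatrix_quadratic_form {E W U : Type*} [Fintype E] [Fintype W] [DecidableEq W]
    [Fintype U] [DecidableEq U] {p : E → ℝ} {s : E → W} {τ : E → E} {F : E → U → U → ℝ}
    {ν : W → ℝ} (hν : ∀ e, p e ≠ 0 → 0 < ν (s e)) (hp : ∀ e, p (τ e) = p e) (g : W → U) :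
    (fun v : W × U => if v.2 = g v.1 then √(ν v.1) else 0) ⬝ᵥ
      (edgeMatrix p s τ F ν *ᵥ fun v : W × U => if v.2 = g v.1 then √(ν v.1) else 0) =
      ∑ e, p e * F e (g (s e)) (g (s (τ e))) := by
  have h1 : ∀ e u, ∑ u', p e * (F e u u' * ((if u' = g (s (τ e)) then √(ν (s (τ e))) else 0) /
      √(ν (s (τ e))))) = p e * F e u (g (s (τ e))) := by
    intro e u
    rw [Finset.sum_eq_single (g (s (τ e)))]
    · by_cases he : p e = 0
      · simp [he]
      · have := hν (τ e) (by rwa [hp])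
        rw [if_pos rfl, div_self (Real.sqrt_pos.2 this).ne', mul_one]
    · intro u' _ hu'
      simp [hu']
    · simp
  have h2 : ∀ w u, (edgeMatrix p s τ F ν *ᵥ fun v : W × U =>
      if v.2 = g v.1 then √(ν v.1) else 0) (w, u) =
      (∑ e, if s e = w then p e * F e u (g (s (τ e))) else 0) / √(ν w) := by
    intro w u
    rw [edgeMatrix_mulVec_apply]
    congr 1
    refine Finset.sum_congr rfl fun e _ => ?_
    split_ifs with h
    · exact h1 e u
    · simp
  rw [dotProduct, Fintype.sum_prod_type]
  simp only [h2]
  simp only [ite_mul, zero_mul, Finset.sum_ite_eq', Finset.mem_univ, if_true]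
  have h3 : ∀ w, √(ν w) * ((∑ e, if s e = w then p e * F e (g w) (g (s (τ e))) else 0) / √(ν w)) =
      ∑ e, if s e = w then p e * F e (g w) (g (s (τ e))) else 0 := by
    intro w
    rcases eq_or_ne (√(ν w)) 0 with h | h
    · rw [h, zero_mul, eq_comm]
      refine Finset.sum_eq_zero fun e _ => ?_
      split_ifs with he
      · by_cases hpe : p e = 0
        · simp [hpe]
        · have := hν e hpe
          rw [he] at this
          exact absurd h (Real.sqrt_pos.2 this).ne'
      · rfl
    · field_simp
  simp only [h3]
  rw [Finset.sum_comm]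
  simp

open Matrix in
/-- If the sign of every bit `x i` is a weighted average of `F i e` over the labels `g x` of the
end points of the edges `e`, then `n` is bounded in terms of the number of vertices. -/
theorem le_of_edge_decoding {n : ℕ} {E W U : Type*} [Fintype E] [Fintype W] [DecidableEq W]
    [Fintype U] [DecidableEq U] {p : E → ℝ} {s : Fin n → E → W} {τ : E → E}
    {F : Fin n → E → U → U → ℝ} {ν : W → ℝ} {L : ℝ}
    (hn : 0 < n) (hτ : Function.Involutive τ) (hp : ∀ e, p (τ e) = p e) (hp0 : ∀ e, 0 ≤ p e)
    (hF : ∀ i e u u', F i e u u' ^ 2 ≤ 1) (hFτ : ∀ i e u u', F i (τ e) u u' = F i e u' u)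
    (hν : ∀ w, 0 ≤ ν w) (hL0 : 0 ≤ L)
    (hL : ∀ i w, (∑ e, if s i e = w then p e else 0) ≤ L * ν w)
    (hN : ∀ w, ∑ i, (∑ e, if s i e = w then p e else 0) ≤ n * ν w)
    (hν4 : ∑ w, ν w = 4) (g : (Fin n → Bool) → W → U)
    (hg : ∀ x i, ∑ e, p e * F i e (g x (s i e)) (g x (s i (τ e))) = 2 * (x i).signReal)
    {k : ℕ} (hk : k ≠ 0) (hV : Fintype.card (W × U) ≤ 2 ^ k) :
    (n : ℝ) ≤ 16 * k * (Fintype.card U ^ 2 * L) := by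
  classical
  set φ : (Fin n → Bool) → W × U → ℝ :=
    fun x v => if v.2 = g x v.1 then √(ν v.1) else 0 with hφ
  have hφφ : ∀ x, φ x ⬝ᵥ φ x = 4 := by
    intro x
    rw [dotProduct, Fintype.sum_prod_type, ← hν4]
    refine Finset.sum_congr rfl fun w _ => ?_
    simp [hφ, Real.mul_self_sqrt (hν w)]
  have hpos : ∀ i e, p e ≠ 0 → 0 < ν (s i e) := by
    intro i e he
    refine (hν _).lt_of_ne' fun h0 => he (le_antisymm ?_ (hp0 e))
    have h1 := hL i (s i e)
    rw [h0, mul_zero] at h1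
    refine le_trans ?_ h1
    have := Finset.single_le_sum (f := fun e' => if s i e' = s i e then p e' else 0)
      (fun e' _ => by split_ifs; exacts [hp0 _, le_rfl]) (Finset.mem_univ e)
    simpa using this
  have hq : ∀ x, φ x ⬝ᵥ (signedSum (fun i => edgeMatrix p (s i) τ (F i) ν) x *ᵥ φ x) = 2 * n := by
    intro x
    have h1 : ∀ i, φ x ⬝ᵥ (((x i).signReal • edgeMatrix p (s i) τ (F i) ν) *ᵥ φ x) = 2 := by
      intro i
      rw [smul_mulVec, dotProduct_smul, hφ, edgeMatrix_quadratic_form (hpos i) hp (g x), hg,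
        smul_eq_mul, mul_left_comm, Bool.signReal_mul_self, mul_one]
    rw [signedSum, sum_mulVec, dotProduct_sum]
    simp only [h1]
    simp [mul_comm]
  have hw : ∀ y : W × U → ℝ, ∑ i, (edgeMatrix p (s i) τ (F i) ν *ᵥ y) ⬝ᵥ
      (edgeMatrix p (s i) τ (F i) ν *ᵥ y) ≤ (Fintype.card U ^ 2 * L * n) * (y ⬝ᵥ y) := by
    intro y
    calc _ ≤ ∑ i, Fintype.card U ^ 2 * L *
          ∑ w, ∑ u, (∑ e, if s i e = w then p e else 0) / ν w * y (w, u) ^ 2 :=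
          Finset.sum_le_sum fun i _ =>
            edgeMatrix_mulVec_dotProduct_le hτ hp hp0 (hF i) hν hL0 (hL i) y
      _ = Fintype.card U ^ 2 * L *
          ∑ w, ∑ u, (∑ i, ∑ e, if s i e = w then p e else 0) / ν w * y (w, u) ^ 2 := by
          rw [← Finset.mul_sum, Finset.sum_comm]
          congr 1
          refine Finset.sum_congr rfl fun w _ => ?_
          rw [Finset.sum_comm]
          refine Finset.sum_congr rfl fun u _ => ?_
          rw [← Finset.sum_mul, ← Finset.sum_div]
      _ ≤ Fintype.card U ^ 2 * L * ∑ w, ∑ u, n * y (w, u) ^ 2 := by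
          gcongr with w _ u _
          exact div_le_of_le_mul₀ (hν w) (Nat.cast_nonneg _) (hN w)
      _ = _ := by
          simp only [← Finset.mul_sum, dotProduct, Fintype.sum_prod_type, sq]
          ring
  have hmain := sq_le_of_quadratic_form_signedSum
    (fun i => isHermitian_edgeMatrix hτ hp (hFτ i)) (by positivity) hw
    (α := n / 2) (by positivity) φ (fun x => by rw [hφφ]; norm_num)
    (fun x => by rw [hφφ, hq]; linarith) hk hV
  have hn' : (0 : ℝ) < n := by exact_mod_cast hn
  refine le_of_mul_le_mul_right ?_ hn'
  linarith

theorem PIRScheme.exists_decoder {n t ℓ b : ℕ} {P : PIRScheme n t ℓ} (h : P.UsesBits b)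
    (i : Fin n) (r : Fin P.R) :
    ∃ (σ : Bool → Fin b → Fin ℓ) (F : (Fin b → Bool) → (Fin b → Bool) → Bool),
      ∀ a0 a1, P.out i r a0 a1 = F (a0 ∘ σ false) (a1 ∘ σ true) := by
  obtain ⟨S0, S1, h0, h1, hS⟩ := h i r
  refine ⟨fun j => if j then S1.orderEmbOfFin h1 else S0.orderEmbOfFin h0,
    fun u u' => P.out i r (Function.extend (S0.orderEmbOfFin h0) u fun _ => false)
      (Function.extend (S1.orderEmbOfFin h1) u' fun _ => false), fun a0 a1 => ?_⟩
  refine hS _ _ _ _ (fun k hk => ?_) (fun k hk => ?_)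
  · obtain ⟨m, rfl⟩ : k ∈ Set.range (S0.orderEmbOfFin h0) := by
      rw [Finset.range_orderEmbOfFin]
      exact hk
    simp [(S0.orderEmbOfFin h0).injective.extend_apply]
  · obtain ⟨m, rfl⟩ : k ∈ Set.range (S1.orderEmbOfFin h1) := by
      rw [Finset.range_orderEmbOfFin]
      exact hk
    simp [(S1.orderEmbOfFin h1).injective.extend_apply]

theorem PIRScheme.out_eq_of_correct {n t ℓ : ℕ} {P : PIRScheme n t ℓ} (hd : P.ProbDist)
    (hc : P.Correct (1 / 2)) (x : Fin n → Bool) (i : Fin n) (r : Fin P.R) (hr : P.pr r ≠ 0) :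
    P.out i r (P.ans1 x (P.q1 i r)) (P.ans2 x (P.q2 i r)) = x i := by
  by_contra hne
  have h1 := hc x i
  have h2 : ∑ r ∈ Finset.univ.filter
      (fun r => P.out i r (P.ans1 x (P.q1 i r)) (P.ans2 x (P.q2 i r)) = x i), P.pr r <
      ∑ r, P.pr r :=
    Finset.sum_lt_sum_of_subset (Finset.filter_subset _ _) (Finset.mem_univ r)
      (by simp [hne]) ((hd.1 r).lt_of_ne' hr) (fun j _ _ => hd.1 j)
  rw [hd.2] at h2
  linarith

theorem eq_of_sum_abs_sub_nonpos {Q : Type*} [Fintype Q] {f g : Q → ℝ}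
    (h : 1 / 2 * ∑ q, |f q - g q| ≤ 0) (q : Q) : f q = g q := by
  have h1 := Finset.single_le_sum (f := fun q => |f q - g q|) (fun q _ => abs_nonneg _)
    (Finset.mem_univ q)
  have h2 : |f q - g q| ≤ 0 := by
    linarith
  exact sub_eq_zero.1 (abs_nonpos_iff.1 h2)

/-- The query to the server `j`. -/
def PIRScheme.query {n t ℓ : ℕ} (P : PIRScheme n t ℓ) (j : Bool) (i : Fin n) (r : Fin P.R) :
    Fin t → Bool :=
  if j then P.q2 i r else P.q1 i r

/-- The answer of the server `j`. -/
def PIRScheme.answer {n t ℓ : ℕ} (P : PIRScheme n t ℓ) (j : Bool) (x : Fin n → Bool)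
    (q : Fin t → Bool) : Fin ℓ → Bool :=
  if j then P.ans2 x q else P.ans1 x q

/-- The probability that the server `j` receives the query `q` when the user wants bit `i`. -/
def PIRScheme.queryDist {n t ℓ : ℕ} (P : PIRScheme n t ℓ) (j : Bool) (i : Fin n)
    (q : Fin t → Bool) : ℝ :=
  ∑ r, if P.query j i r = q then P.pr r else 0

theorem PIRScheme.queryDist_eq {n t ℓ : ℕ} {P : PIRScheme n t ℓ} (h : P.Secure 0) (j : Bool)
    (i i' : Fin n) (q : Fin t → Bool) : P.queryDist j i q = P.queryDist j i' q := by
  obtain ⟨h1, h2⟩ := h i i'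
  cases j
  · simpa [queryDist, query, Finset.sum_filter] using eq_of_sum_abs_sub_nonpos h1 q
  · simpa [queryDist, query, Finset.sum_filter] using eq_of_sum_abs_sub_nonpos h2 q

theorem PIRScheme.le_of_usesBits {n t ℓ b : ℕ} (P : PIRScheme n t ℓ) (hn : 0 < n) (hℓ : 0 < ℓ)
    (hd : P.ProbDist) (hc : P.Correct (1 / 2)) (hs : P.Secure 0) (hb : P.UsesBits b) :
    (n : ℝ) ≤ 16 * ((1 + t + b * ℓ + b : ℕ) : ℝ) * (((2 : ℝ) ^ b) ^ 2 * (ℓ : ℝ) ^ b) := by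
  choose σ D hD using PIRScheme.exists_decoder hb
  let i₀ : Fin n := ⟨0, hn⟩
  let p : Bool × Fin P.R → ℝ := fun e => P.pr e.2
  let s : Fin n → Bool × Fin P.R → Bool × (Fin t → Bool) × (Fin b → Fin ℓ) :=
    fun i e => (e.1, P.query e.1 i e.2, σ i e.2 e.1)
  let τ : Bool × Fin P.R → Bool × Fin P.R := fun e => (!e.1, e.2)
  let F : Fin n → Bool × Fin P.R → (Fin b → Bool) → (Fin b → Bool) → ℝ :=
    fun i e u u' => (if e.1 then D i e.2 u' u else D i e.2 u u').signReal
  let m : Fin n → Bool × (Fin t → Bool) × (Fin b → Fin ℓ) → ℝ :=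
    fun i w => ∑ e, if s i e = w then p e else 0
  let ν : Bool × (Fin t → Bool) × (Fin b → Fin ℓ) → ℝ :=
    fun w => P.queryDist w.1 i₀ w.2.1 / ℓ ^ b + (∑ i, m i w) / n
  have hn' : (0 : ℝ) < n := by exact_mod_cast hn
  have hℓ' : (0 : ℝ) < ℓ := by exact_mod_cast hℓ
  have hm0 : ∀ i w, 0 ≤ m i w := fun i w => Finset.sum_nonneg fun e _ => by
    split_ifs
    exacts [hd.1 _, le_rfl]
  have hq0 : ∀ j q, 0 ≤ P.queryDist j i₀ q := fun j q => Finset.sum_nonneg fun e _ => by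
    split_ifs
    exacts [hd.1 _, le_rfl]
  have hmq : ∀ i w, m i w ≤ P.queryDist w.1 i₀ w.2.1 := by
    rintro i ⟨j, q, ρ⟩
    rw [PIRScheme.queryDist_eq hs j i₀ i]
    simp only [m, s, p, Fintype.sum_prod_type, Prod.mk.injEq]
    rw [Finset.sum_eq_single j]
    · refine Finset.sum_le_sum fun r _ => ?_
      by_cases h : P.query j i r = q
      · simp only [h, true_and, if_true]
        split_ifs
        exacts [le_rfl, hd.1 _]
      · simp [h]
    · intro j' _ hj'
      simp [hj']
    · simp
  have hms : ∀ i, ∑ w, m i w = 2 := by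
    intro i
    simp only [m]
    rw [Finset.sum_comm]
    simp [p, Fintype.sum_prod_type, hd.2]
  have hqs : ∀ j, ∑ q, P.queryDist j i₀ q = 1 := by
    intro j
    simp only [PIRScheme.queryDist]
    rw [Finset.sum_comm]
    simp [hd.2]
  have h := le_of_edge_decoding (p := p) (s := s) (τ := τ) (F := F) (ν := ν) (L := ℓ ^ b)
    (k := 1 + t + b * ℓ + b) hn (fun e => by simp [τ]) (fun e => rfl) (fun e => hd.1 _)
    (fun i e u u' => by simp [F, sq, Bool.signReal_mul_self])
    (fun i e u u' => by rcases e with ⟨_ | _, r⟩ <;> simp [F, τ])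
    (fun w => add_nonneg (div_nonneg (hq0 _ _) (by positivity))
      (div_nonneg (Finset.sum_nonneg fun i _ => hm0 i w) hn'.le))
    (by positivity) ?_ ?_ ?_ (fun x w k => P.answer w.1 x w.2.1 (w.2.2 k)) ?_ (by omega) ?_
  · simpa using h
  · intro i w
    have h1 : 0 ≤ (ℓ : ℝ) ^ b * ((∑ i, m i w) / n) :=
      mul_nonneg (by positivity) (div_nonneg (Finset.sum_nonneg fun i _ => hm0 i w) hn'.le)
    have h2 : (ℓ : ℝ) ^ b * (P.queryDist w.1 i₀ w.2.1 / ℓ ^ b) = P.queryDist w.1 i₀ w.2.1 := by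
      field_simp
    have h3 := hmq i w
    simp only [ν, mul_add]
    change m i w ≤ _
    linarith
  · intro w
    have h1 : 0 ≤ (n : ℝ) * (P.queryDist w.1 i₀ w.2.1 / ℓ ^ b) :=
      mul_nonneg hn'.le (div_nonneg (hq0 _ _) (by positivity))
    have h2 : (n : ℝ) * ((∑ i, m i w) / n) = ∑ i, m i w := by
      field_simp
    simp only [ν, mul_add]
    change ∑ i, m i w ≤ _
    linarith
  · simp only [ν, Finset.sum_add_distrib, ← Finset.sum_div]
    rw [Finset.sum_comm]
    simp only [hms, Fintype.sum_prod_type, Finset.sum_const, Finset.card_univ, Fintype.card_fun,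
      Fintype.card_fin, nsmul_eq_mul, ← Finset.mul_sum, hqs, Fintype.card_bool]
    push_cast
    field_simp
    norm_num
  · intro x i
    have key : ∀ j r, p (j, r) * F i (j, r)
        (fun k => P.answer j x (P.query j i r) (σ i r j k))
        (fun k => P.answer (!j) x (P.query (!j) i r) (σ i r (!j) k)) =
        P.pr r * (x i).signReal := by
      intro j r
      by_cases hr : P.pr r = 0
      · simp [p, hr]
      · rw [← PIRScheme.out_eq_of_correct hd hc x i r hr, hD]
        cases j <;> rfl
    rw [Fintype.sum_prod_type]
    simp only [s, τ, key]
    simp [← Finset.sum_mul, hd.2]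
  · simp only [Fintype.card_prod, Fintype.card_fun, Fintype.card_bool, Fintype.card_fin]
    rw [pow_add, pow_add, pow_add, pow_one, mul_comm b ℓ, pow_mul, ← mul_assoc]
    gcongr
    exact Nat.lt_two_pow_self.le

/-- for every fixed `b ≥ 1` there is a constant `K > 0` such that every
one-round 2-server PIR scheme with perfect recovery (`ε = 1/2`) and perfect privacy
(`η = 0`) that uses `b` bits has total communication `2(t + ℓ) ≥ K · n^{1/(b+1)}`. -/
theorem stmt16 (b : ℕ) (hb : 1 ≤ b) :
    ∃ K : ℝ, 0 < K ∧
      ∀ (n t ℓ : ℕ) (P : PIRScheme n t ℓ),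
        P.ProbDist → P.Correct (1 / 2) → P.Secure 0 → P.UsesBits b →
        K * (n : ℝ) ^ ((1 : ℝ) / (b + 1)) ≤ 2 * (t + ℓ) := by
  set Q : ℝ := 16 * (2 * b + 1) * (2 ^ b) ^ 2 with hQ
  have hQ1 : 1 ≤ Q := by
    have h1 : (1 : ℝ) ≤ (2 ^ b) ^ 2 := one_le_pow₀ (one_le_pow₀ one_le_two)
    have h2 : (1 : ℝ) ≤ 16 * (2 * b + 1) := by
      have : (0 : ℝ) ≤ b := Nat.cast_nonneg b
      linarith
    exact one_le_mul_of_one_le_of_one_le h2 h1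
  have hQ0 : 0 < Q := by linarith
  refine ⟨2 / Q, by positivity, fun n t ℓ P hd hc hs hu => ?_⟩
  rcases Nat.eq_zero_or_pos n with rfl | hn
  · rw [Nat.cast_zero, Real.zero_rpow (by positivity)]
    simp only [mul_zero]
    positivity
  have hR : Nonempty (Fin P.R) := by
    by_contra hR
    rw [not_nonempty_iff] at hR
    simpa using hd.2
  obtain ⟨r⟩ := hR
  have hℓ : 0 < ℓ := by
    obtain ⟨S, -, hS, -⟩ := hu ⟨0, hn⟩ r
    have := S.card_le_univ
    rw [Fintype.card_fin] at this
    omega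
  have h := P.le_of_usesBits hn hℓ hd hc hs hu
  have hℓ1 : (1 : ℝ) ≤ ℓ := by exact_mod_cast hℓ
  have hk : ((1 + t + b * ℓ + b : ℕ) : ℝ) ≤ (2 * b + 1) * (t + ℓ) := by
    push_cast
    have hb0 : (0 : ℝ) ≤ b := Nat.cast_nonneg b
    have ht0 : (0 : ℝ) ≤ t := Nat.cast_nonneg t
    nlinarith [mul_nonneg hb0 ht0, mul_nonneg hb0 (sub_nonneg.2 hℓ1)]
  have hle : (n : ℝ) ≤ (Q * (t + ℓ)) ^ (b + 1) := by
    calc (n : ℝ) ≤ _ := h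
      _ ≤ 16 * ((2 * b + 1) * (t + ℓ)) * (((2 : ℝ) ^ b) ^ 2 * (t + ℓ : ℝ) ^ b) := by
          gcongr
          linarith [(Nat.cast_nonneg t : (0 : ℝ) ≤ t)]
      _ = Q ^ 1 * (t + ℓ) ^ (b + 1) := by
          rw [hQ]
          ring
      _ ≤ Q ^ (b + 1) * (t + ℓ) ^ (b + 1) := by
          gcongr ?_ * _
          exact pow_le_pow_right₀ hQ1 (by omega)
      _ = _ := (mul_pow _ _ _).symm
  have hroot : (n : ℝ) ^ ((1 : ℝ) / (b + 1)) ≤ Q * (t + ℓ) := by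
    calc (n : ℝ) ^ ((1 : ℝ) / (b + 1))
        ≤ ((Q * (t + ℓ)) ^ (b + 1)) ^ ((1 : ℝ) / (b + 1)) := by gcongr
      _ = Q * (t + ℓ) := by
          have := Real.pow_rpow_inv_natCast (x := Q * (t + ℓ)) (by positivity)
            (Nat.succ_ne_zero b)
          rw [one_div]
          simpa using this
  calc 2 / Q * (n : ℝ) ^ ((1 : ℝ) / (b + 1)) ≤ 2 / Q * (Q * (t + ℓ)) := by gcongr
    _ = 2 * (t + ℓ) := by field_simp
end
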